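/- arXiv:math/0609843 — 2 statements merged into one kernel-verified Lean document; each statement's English description precedes it below -/
import Mathlib

section
/- The topological space Ā is compact Hausdorff (and second countable). -/
/-!
Common setup for Werner, "Compactifications of Bruhat-Tits buildings associated to
linear representations":  a finite-dimensional real vector space `A` (the apartment),
a root system `Φ` in the dual space together with a Weyl-group invariant inner
product, a finite Weyl-invariant set `Λ` of (K-)weights, and for every basis `Δ`
of `Φ` a highest weight `lam0 Δ ∈ Λ`.
-/

open Pointwise Filter Topology Bornology
open scoped Classical

noncomputable section

/-- A set `M` of linear forms is *connected* if the graph with vertex set `M` and an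
edge between `m` and `n` iff `inn m n ≠ 0` is connected. -/
def GraphConnected {D : Type*} (inn : D → D → ℝ) (M : Set D) : Prop :=
  ∀ m ∈ M, ∀ n ∈ M,
    Relation.ReflTransGen (fun x y => x ∈ M ∧ y ∈ M ∧ inn x y ≠ 0) m n

/-- The coefficients of `μ` as a linear combination of the elements of `Δ` (chosen
arbitrarily if one exists; it is unique when `Δ` is linearly independent). -/
noncomputable def coeffs {A : Type*} [AddCommGroup A] [Module ℝ A]
    (Δ : Finset (Module.Dual ℝ A)) (μ : Module.Dual ℝ A) : Module.Dual ℝ A → ℝ :=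
  if h : ∃ n : Module.Dual ℝ A → ℝ, μ = ∑ b ∈ Δ, n b • b then h.choose else fun _ => 0

/-- The support `[μ]` of `μ` with respect to the basis `Δ`: the set of elements of `Δ`
whose coefficient in `μ` is nonzero. -/
noncomputable def supp {A : Type*} [AddCommGroup A] [Module ℝ A]
    (Δ : Finset (Module.Dual ℝ A)) (μ : Module.Dual ℝ A) : Finset (Module.Dual ℝ A) :=
  Δ.filter fun a => coeffs Δ μ a ≠ 0

/-- Raw data: a finite set `Φ` of roots in the dual of `A`, a product `inn` on the dual,
a finite set `Λ` of weights, and a highest weight `lam0 Δ` for every basis `Δ`. -/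
structure RootWeightData (A : Type*) [NormedAddCommGroup A] [NormedSpace ℝ A]
    [FiniteDimensional ℝ A] where
  Φ : Finset (Module.Dual ℝ A)
  inn : Module.Dual ℝ A → Module.Dual ℝ A → ℝ
  Λ : Finset (Module.Dual ℝ A)
  lam0 : Finset (Module.Dual ℝ A) → Module.Dual ℝ A

namespace RootWeightData

variable {A : Type*} [NormedAddCommGroup A] [NormedSpace ℝ A] [FiniteDimensional ℝ A]
variable (S : RootWeightData A)

/-- The reflection associated to the root `a`. -/
def refl (a : Module.Dual ℝ A) : Function.End (Module.Dual ℝ A) :=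
  fun x => x - (2 * S.inn x a / S.inn a a) • a

/-- The Weyl group `W`, generated by the reflections in the roots. -/
def weyl : Submonoid (Function.End (Module.Dual ℝ A)) :=
  Submonoid.closure {f | ∃ a ∈ S.Φ, f = S.refl a}

/-- `Δ` is a basis of the root system `Φ`: a linearly independent subset of `Φ` such
that every root is a nonnegative or nonpositive linear combination of `Δ`. -/
def IsBase (Δ : Finset (Module.Dual ℝ A)) : Prop :=
  (↑Δ : Set (Module.Dual ℝ A)) ⊆ (S.Φ : Set (Module.Dual ℝ A)) ∧
  LinearIndependent ℝ (fun a : (Δ : Set (Module.Dual ℝ A)) => (a : Module.Dual ℝ A)) ∧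
  ∀ a ∈ S.Φ,
    (∃ n : Module.Dual ℝ A → ℝ, (∀ b ∈ Δ, 0 ≤ n b) ∧ a = ∑ b ∈ Δ, n b • b) ∨
    (∃ n : Module.Dual ℝ A → ℝ, (∀ b ∈ Δ, 0 ≤ n b) ∧ a = -∑ b ∈ Δ, n b • b)

/-- `Y` is an admissible subset of the basis `Δ`: `Y ⊆ Δ` and `Y ∪ {λ₀(Δ)}` is
connected. -/
def Admissible (Δ Y : Finset (Module.Dual ℝ A)) : Prop :=
  Y ⊆ Δ ∧ GraphConnected S.inn ((↑Y : Set (Module.Dual ℝ A)) ∪ {S.lam0 Δ})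

end RootWeightData

/-- The whole setting of Werner's paper: the data of `RootWeightData`, where `Φ` is a
(crystallographic, possibly non-reduced) root system spanning the dual of `A`, `inn` is
a Weyl-invariant inner product, `Λ` is a finite Weyl-invariant set of weights, and
`lam0` picks, Weyl-equivariantly, a highest weight for each basis, dominating all of
`Λ`; moreover a subset of a basis is admissible iff it is the support of
`λ₀(Δ) - λ` for some weight `λ`. -/
structure RootWeightSystem (A : Type*) [NormedAddCommGroup A] [NormedSpace ℝ A]
    [FiniteDimensional ℝ A] extends RootWeightData A where
  inn_symm : ∀ x y, inn x y = inn y x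
  inn_add_left : ∀ x y z, inn (x + y) z = inn x z + inn y z
  inn_smul_left : ∀ (c : ℝ) (x y), inn (c • x) y = c * inn x y
  inn_pos : ∀ x, x ≠ 0 → 0 < inn x x
  root_ne_zero : ∀ a ∈ Φ, a ≠ (0 : Module.Dual ℝ A)
  neg_mem : ∀ a ∈ Φ, -a ∈ Φ
  refl_mem : ∀ a ∈ Φ, ∀ b ∈ Φ, toRootWeightData.refl a b ∈ Φ
  inn_weyl_invariant :
    ∀ w ∈ toRootWeightData.weyl, ∀ x y, inn (w x) (w y) = inn x y
  phi_spans : Submodule.span ℝ (Φ : Set (Module.Dual ℝ A)) = ⊤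
  exists_base : ∃ Δ, toRootWeightData.IsBase Δ
  base_cover : ∀ x : A, ∃ Δ, toRootWeightData.IsBase Δ ∧ ∀ a ∈ Δ, 0 ≤ a x
  base_weyl : ∀ w ∈ toRootWeightData.weyl, ∀ Δ, toRootWeightData.IsBase Δ →
    toRootWeightData.IsBase (Δ.image (w : Module.Dual ℝ A → Module.Dual ℝ A))
  lam0_mem : ∀ Δ, toRootWeightData.IsBase Δ → lam0 Δ ∈ Λ
  lam0_dominates : ∀ Δ, toRootWeightData.IsBase Δ → ∀ l ∈ Λ,
    ∃ n : Module.Dual ℝ A → ℝ, (∀ a ∈ Δ, 0 ≤ n a) ∧ lam0 Δ - l = ∑ a ∈ Δ, n a • a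
  weight_weyl_invariant : ∀ w ∈ toRootWeightData.weyl, ∀ l ∈ Λ, w l ∈ Λ
  lam0_equivariant : ∀ w ∈ toRootWeightData.weyl, ∀ Δ, toRootWeightData.IsBase Δ →
    lam0 (Δ.image (w : Module.Dual ℝ A → Module.Dual ℝ A)) = w (lam0 Δ)
  integrality : ∀ l ∈ Λ, ∀ a ∈ Φ, ∃ k : ℤ, 2 * inn l a / inn a a = (k : ℝ)
  admissible_iff_support : ∀ Δ, toRootWeightData.IsBase Δ → ∀ Y ⊆ Δ,
    (toRootWeightData.Admissible Δ Y ↔ ∃ l ∈ Λ, supp Δ (lam0 Δ - l) = Y)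

namespace RootWeightSystem

variable {A : Type*} [NormedAddCommGroup A] [NormedSpace ℝ A] [FiniteDimensional ℝ A]
variable (S : RootWeightSystem A)

/-- The face `F_Y^Δ` of the apartment `A` associated to a basis `Δ` and an admissible
subset `Y ⊆ Δ`. -/
def Face (Δ Y : Finset (Module.Dual ℝ A)) : Set A :=
  {x | (∀ a ∈ Y, a x = 0) ∧
    ∀ l ∈ S.Λ, ¬ supp Δ (S.lam0 Δ - l) ⊆ Y → 0 < (S.lam0 Δ - l) x}

/-- `F` belongs to the collection `Σ` of faces. -/
def IsFace (F : Set A) : Prop :=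
  ∃ Δ Y, S.toRootWeightData.IsBase Δ ∧ S.toRootWeightData.Admissible Δ Y ∧
    F = S.Face Δ Y

/-- The collection `Σ` of all faces. -/
def Faces : Type _ := {F : Set A // S.IsFace F}

/-- The relation identifying `(F, u)` and `(F, v)` when `u - v ∈ ⟨F⟩`; the quotient is
the disjoint union `Ā = ⊔_{F ∈ Σ} A/⟨F⟩`. -/
def AbarRel (p q : S.Faces × A) : Prop :=
  p.1 = q.1 ∧ p.2 - q.2 ∈ Submodule.span ℝ p.1.val

/-- The compactified apartment `Ā = ⊔_{F ∈ Σ} A_F`, `A_F = A/⟨F⟩`. -/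
def Abar : Type _ := Quot S.AbarRel

/-- `r_F(u)`, the image of `u ∈ A` in the stratum `A_F` of `Ā`. -/
def mkAbar (F : S.Faces) (u : A) : S.Abar := Quot.mk _ (F, u)

/-- The basic set `Γ_F(U) = ⋃_{F' ⊆ cl F} r_{F'}(U + F)` of `Ā`. -/
def Gamma (F : S.Faces) (U : Set A) : Set S.Abar :=
  {p | ∃ F' : S.Faces, F'.val ⊆ closure F.val ∧ ∃ u ∈ U + F.val, p = S.mkAbar F' u}

/-- The topology of `Ā`, generated by the sets `Γ_F(U)` for `F ∈ Σ` and `U ⊆ A`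
bounded and open. -/
instance : TopologicalSpace S.Abar :=
  TopologicalSpace.generateFrom
    {V : Set S.Abar | ∃ (F : S.Faces) (U : Set A),
      IsOpen U ∧ IsBounded U ∧ V = S.Gamma F U}

/-- `f_Ω(a) = inf {t : Ω ⊆ cl_Ā {z ∈ A : a(z) ≥ -t}} ∈ ℝ ∪ {±∞}`, where `A` is embedded
in `Ā` as the stratum of the face `F₀ = {0}`. -/
def fOmega (F₀ : S.Faces) (Ω : Set S.Abar) (a : Module.Dual ℝ A) : EReal :=
  sInf ((fun t : ℝ => (t : EReal)) ''
    {t : ℝ | Ω ⊆ closure (S.mkAbar F₀ '' {z : A | -t ≤ a z})})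

end RootWeightSystem


set_option linter.unusedSectionVars false

section NormalFan

variable {A : Type*} [NormedAddCommGroup A] [NormedSpace ℝ A] [FiniteDimensional ℝ A]
variable {ι : Type*} [Fintype ι] (w : ι → Module.Dual ℝ A)

/-- The open normal cone of `Q`. -/
def NN (Q : Finset ι) : Set A :=
  {x | ∀ i ∈ Q, (∀ j ∈ Q, w j x = w i x) ∧ ∀ j, j ∉ Q → w j x < w i x}

/-- Normalised exponentials. -/
def PP (Q : Finset ι) (v : A) : ι → ℝ :=
  fun i => if i ∈ Q then Real.exp (w i v) / ∑ j ∈ Q, Real.exp (w j v) else 0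

theorem PP_sum_pos {Q : Finset ι} (hQ : Q.Nonempty) (v : A) :
    0 < ∑ j ∈ Q, Real.exp (w j v) :=
  Finset.sum_pos (fun _ _ => Real.exp_pos _) hQ

theorem PP_pos {Q : Finset ι} (v : A) {i : ι} (hi : i ∈ Q) : 0 < PP w Q v i := by
  have := PP_sum_pos w ⟨i, hi⟩ v
  simp only [PP, hi, if_true]
  positivity

theorem PP_zero {Q : Finset ι} (v : A) {i : ι} (hi : i ∉ Q) : PP w Q v i = 0 := by
  simp [PP, hi]

theorem PP_nonneg (Q : Finset ι) (v : A) (i : ι) : 0 ≤ PP w Q v i := by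
  by_cases hi : i ∈ Q
  · exact (PP_pos w v hi).le
  · exact (PP_zero w v hi).ge

theorem PP_sum {Q : Finset ι} (hQ : Q.Nonempty) (v : A) : ∑ i, PP w Q v i = 1 := by
  have := PP_sum_pos w hQ v
  simp only [PP, Finset.sum_ite_mem, Finset.univ_inter]
  rw [← Finset.sum_div, div_self this.ne']

theorem PP_ratio {Q : Finset ι} (v : A) {i j : ι} (hi : i ∈ Q) (hj : j ∈ Q) :
    PP w Q v i = PP w Q v j * Real.exp (w i v - w j v) := by
  have := PP_sum_pos w ⟨i, hi⟩ v
  simp only [PP, hi, hj, if_true, Real.exp_sub]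
  field_simp

theorem PP_log {Q : Finset ι} (v : A) {i j : ι} (hi : i ∈ Q) (hj : j ∈ Q) :
    Real.log (PP w Q v i) - Real.log (PP w Q v j) = w i v - w j v := by
  rw [PP_ratio w v hi hj, Real.log_mul (PP_pos w v hj).ne' (Real.exp_pos _).ne', Real.log_exp]
  ring

theorem PP_mem_iff {Q : Finset ι} (v : A) {i : ι} : i ∈ Q ↔ PP w Q v i ≠ 0 :=
  ⟨fun h => (PP_pos w v h).ne', fun h => by_contra fun h' => h (PP_zero w v h')⟩

theorem PP_congr {Q : Finset ι} {u v : A} (h : ∀ i ∈ Q, ∀ j ∈ Q, w i (u - v) = w j (u - v)) :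
    PP w Q u = PP w Q v := by
  funext i
  by_cases hi : i ∈ Q
  · have hQ : Q.Nonempty := ⟨i, hi⟩
    have h1 := PP_sum_pos w hQ u
    have h2 := PP_sum_pos w hQ v
    have : ∀ j ∈ Q, Real.exp (w j u) = Real.exp (w i (u - v)) * Real.exp (w j v) := by
      intro j hj
      rw [← Real.exp_add, h i hi j hj, map_sub, sub_add_cancel]
    simp only [PP, hi, if_true]
    rw [Finset.sum_congr rfl this, this i hi, ← Finset.mul_sum,
      mul_div_mul_left _ _ (Real.exp_pos _).ne']
  · rw [PP_zero w u hi, PP_zero w v hi]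

/-- A vector with prescribed values is pushed into the open cone. -/
theorem NN_push {Q Q' : Finset ι} (hQ : Q.Nonempty) (hQQ : Q ⊆ Q') {z f : A} (hf : f ∈ NN w Q')
    (h1 : ∀ i ∈ Q, ∀ j ∈ Q, w j z = w i z)
    (h2 : ∀ i ∈ Q, ∀ j ∈ Q', j ∉ Q → w j z < w i z) :
    ∃ t : ℝ, z + t • f ∈ NN w Q := by
  obtain ⟨i0, hi0⟩ := hQ
  have key : ∀ j, j ∉ Q → ∀ᶠ t : ℝ in atTop, w j (z + t • f) < w i0 (z + t • f) := by
    intro j hj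
    simp only [map_add, map_smul, smul_eq_mul]
    by_cases hj' : j ∈ Q'
    · have := (hf i0 (hQQ hi0)).1 j hj'
      have h3 := h2 i0 hi0 j hj' hj
      exact Filter.Eventually.of_forall fun t => by rw [this]; linarith
    · have := (hf i0 (hQQ hi0)).2 j hj'
      have hd : 0 < w i0 f - w j f := by linarith
      filter_upwards [eventually_gt_atTop ((w j z - w i0 z) / (w i0 f - w j f))] with t ht
      rw [div_lt_iff₀ hd] at ht
      linarith
  have hev : ∀ᶠ t : ℝ in atTop, ∀ j, j ∉ Q → w j (z + t • f) < w i0 (z + t • f) := by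
    rw [eventually_all]
    intro j
    by_cases hj : j ∈ Q
    · exact Filter.Eventually.of_forall fun t h => absurd hj h
    · filter_upwards [key j hj] with t ht _ using ht
  obtain ⟨t, ht⟩ := hev.exists
  have heq : ∀ i ∈ Q, ∀ j ∈ Q, w j (z + t • f) = w i (z + t • f) := by
    intro i hi j hj
    simp only [map_add, map_smul, smul_eq_mul]
    rw [h1 i hi j hj, (hf i (hQQ hi)).1 j (hQQ hj)]
  refine ⟨t, fun i hi => ⟨fun j hj => heq i hi j hj, fun j hj => ?_⟩⟩
  rw [heq i0 hi0 i hi]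
  exact ht j hj

theorem NN_span {Q : Finset ι} (hQ : Q.Nonempty) (hne : (NN w Q).Nonempty) (z : A) :
    z ∈ Submodule.span ℝ (NN w Q) ↔ ∀ i ∈ Q, ∀ j ∈ Q, w j z = w i z := by
  constructor
  · intro hz i hi j hj
    induction hz using Submodule.span_induction with
    | mem x hx => exact (hx i hi).1 j hj
    | zero => simp
    | add x y _ _ hx hy => simp [hx, hy]
    | smul a x _ hx => simp [hx]
  · intro h
    obtain ⟨f, hf⟩ := hne
    obtain ⟨t, ht⟩ := NN_push w hQ (Finset.Subset.refl Q) hf h (fun i _ j hj hj' => absurd hj hj')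
    have h3 := Submodule.sub_mem _ (Submodule.subset_span ht)
      (Submodule.smul_mem _ t (Submodule.subset_span hf))
    simpa using h3

theorem NN_add {Q Q' : Finset ι} (hQQ : Q ⊆ Q') {x y : A} (hx : x ∈ NN w Q) (hy : y ∈ NN w Q') :
    x + y ∈ NN w Q := by
  intro i hi
  refine ⟨fun j hj => ?_, fun j hj => ?_⟩
  · rw [map_add, map_add, (hx i hi).1 j hj, (hy i (hQQ hi)).1 j (hQQ hj)]
  · rw [map_add, map_add]
    have h1 := (hx i hi).2 j hj
    by_cases hj' : j ∈ Q'
    · have := (hy i (hQQ hi)).1 j hj'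
      linarith
    · have := (hy i (hQQ hi)).2 j hj'
      linarith

theorem NN_smul {Q : Finset ι} {x : A} (hx : x ∈ NN w Q) {t : ℝ} (ht : 0 < t) :
    t • x ∈ NN w Q := by
  intro i hi
  refine ⟨fun j hj => ?_, fun j hj => ?_⟩
  · simp [(hx i hi).1 j hj]
  · simp [(hx i hi).2 j hj, ht]

theorem dual_cont (l : Module.Dual ℝ A) : Continuous l := LinearMap.continuous_of_finiteDimensional l

theorem NN_closure {Q Q' : Finset ι} (hQ' : Q'.Nonempty)
    (hne : (NN w Q).Nonempty) (hne' : (NN w Q').Nonempty) :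
    NN w Q' ⊆ closure (NN w Q) ↔ Q ⊆ Q' := by
  constructor
  · intro h i hi
    obtain ⟨x, hx⟩ := hne'
    obtain ⟨k, hk⟩ := hQ'
    have hcl : IsClosed {y : A | w k y ≤ w i y} := isClosed_le (dual_cont _) (dual_cont _)
    have hsub : NN w Q ⊆ {y : A | w k y ≤ w i y} := by
      intro y hy
      by_cases hkQ : k ∈ Q
      · exact ((hy i hi).1 k hkQ).le
      · exact ((hy i hi).2 k hkQ).le
    have h3 : w k x ≤ w i x := closure_minimal hsub hcl (h hx)
    by_contra hi'
    exact absurd ((hx k hk).2 i hi') (not_lt.mpr h3)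
  · intro h x hx
    obtain ⟨f, hf⟩ := hne
    have ht : Tendsto (fun t : ℝ => t • f + x) (𝓝[>] 0) (𝓝 x) := by
      have : Tendsto (fun t : ℝ => t • f + x) (𝓝 0) (𝓝 ((0:ℝ) • f + x)) :=
        Continuous.tendsto (by fun_prop) 0
      rw [zero_smul, zero_add] at this
      exact this.mono_left nhdsWithin_le_nhds
    refine mem_closure_of_tendsto ht ?_
    filter_upwards [self_mem_nhdsWithin] with t ht
    exact NN_add w h (NN_smul w hf ht) hx

theorem NN_unique {Q Q' : Finset ι} (hQ : Q.Nonempty) (hQ' : Q'.Nonempty) {x : A}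
    (hx : x ∈ NN w Q) (hx' : x ∈ NN w Q') : Q = Q' := by
  obtain ⟨i, hi⟩ := hQ
  obtain ⟨k, hk⟩ := hQ'
  have aux : ∀ {R R' : Finset ι} {i k : ι}, i ∈ R → k ∈ R' → x ∈ NN w R → x ∈ NN w R' → R ⊆ R' := by
    intro R R' i k _ hk h h' j hj
    by_contra hj'
    have h1 := (h' k hk).2 j hj'
    by_cases hkR : k ∈ R
    · exact absurd ((h j hj).1 k hkR) h1.ne'
    · exact absurd ((h j hj).2 k hkR) h1.asymm
  exact Finset.Subset.antisymm (aux hi hk hx hx') (aux hk hi hx' hx)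

/-- Differences of the weights in `Q`. -/
def LL (Q : Finset ι) (i0 : ι) : A →ₗ[ℝ] (ι → ℝ) :=
  LinearMap.pi fun i => if i ∈ Q then w i - w i0 else 0

theorem LL_apply (Q : Finset ι) (i0 i : ι) (v : A) :
    LL w Q i0 v i = if i ∈ Q then w i v - w i0 v else 0 := by
  by_cases h : i ∈ Q <;> simp [LL, h]

/-- Differences of logarithms. -/
def psi (Q : Finset ι) (i0 : ι) (z : ι → ℝ) : ι → ℝ :=
  fun i => if i ∈ Q then Real.log (z i) - Real.log (z i0) else 0

theorem psi_PP {Q Q' : Finset ι} {i0 : ι} (hi0 : i0 ∈ Q) (hQQ : Q ⊆ Q') (v : A) :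
    psi Q i0 (PP w Q' v) = LL w Q i0 v := by
  funext i
  rw [LL_apply, psi]
  by_cases h : i ∈ Q
  · simp only [h, if_true]
    exact PP_log w v (hQQ h) (hQQ hi0)
  · simp [h]

theorem psi_cont {Q : Finset ι} {i0 : ι} (hi0 : i0 ∈ Q) {y : ι → ℝ} (hy : ∀ i ∈ Q, y i ≠ 0) :
    ContinuousAt (psi Q i0) y := by
  refine continuousAt_pi.2 fun i => ?_
  by_cases h : i ∈ Q
  · simp only [psi, h, if_true]
    exact ((continuousAt_apply i y).log (hy i h)).sub ((continuousAt_apply i0 y).log (hy i0 hi0))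
  · simp only [psi, h, if_false]
    exact continuousAt_const

theorem exists_pinv (L : A →ₗ[ℝ] (ι → ℝ)) : ∃ G : (ι → ℝ) →ₗ[ℝ] A, ∀ v, L (G (L v)) = L v := by
  obtain ⟨g, hg⟩ := L.rangeRestrict.exists_rightInverse_of_surjective (LinearMap.range_rangeRestrict L)
  obtain ⟨G, hG⟩ := LinearMap.exists_extend g
  refine ⟨G, fun v => ?_⟩
  have h1 : G (L v) = g (L.rangeRestrict v) := by
    rw [← hG]; rfl
  have h2 := congrArg Subtype.val (LinearMap.congr_fun hg (L.rangeRestrict v))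
  rw [h1]
  simpa using h2

theorem key_nbhd {Q : Finset ι} (hQ : Q.Nonempty) {x : A} {U : Set A} (hU : IsOpen U) (hx : x ∈ U) :
    ∀ᶠ z in 𝓝 (PP w Q x), ∀ (Q' : Finset ι) (v f : A), f ∈ NN w Q' → PP w Q' v = z →
      Q ⊆ Q' ∧ ∃ u ∈ U, ∃ h ∈ NN w Q, ∃ t : ℝ, v + t • f = u + h := by
  obtain ⟨i0, hi0⟩ := hQ
  obtain ⟨G, hG⟩ := exists_pinv (LL w Q i0)
  have hGc : Continuous G := LinearMap.continuous_of_finiteDimensional G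
  set y := PP w Q x with hy
  let e : (ι → ℝ) → A := fun z => G (psi Q i0 z - psi Q i0 y)
  have hec : ContinuousAt e y :=
    hGc.continuousAt.comp
      ((psi_cont hi0 fun i hi => (PP_pos w x hi).ne').sub continuousAt_const)
  have he0 : e y = 0 := by simp [e]
  have E1 : ∀ᶠ z in 𝓝 y, ∀ i, i ∈ Q → 0 < z i := by
    rw [eventually_all]
    intro i
    by_cases hi : i ∈ Q
    · filter_upwards [(continuousAt_apply i y).eventually (lt_mem_nhds (PP_pos w x hi))] with z hz _
      exact hz
    · exact Filter.Eventually.of_forall fun z h => absurd h hi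
  have E2 : ∀ᶠ z in 𝓝 y, x + e z ∈ U := by
    have : ContinuousAt (fun z => x + e z) y := continuousAt_const.add hec
    refine this.eventually (hU.mem_nhds ?_)
    simpa [he0] using hx
  have E3 : ∀ᶠ z in 𝓝 y, ∀ i, i ∉ Q →
      z i < z i0 * Real.exp (w i (x + e z) - w i0 (x + e z)) := by
    rw [eventually_all]
    intro i
    by_cases hi : i ∈ Q
    · exact Filter.Eventually.of_forall fun z h => absurd hi h
    · have c1 : ∀ k, ContinuousAt (fun z => w k (x + e z)) y := fun k =>
        (dual_cont (w k)).continuousAt.comp (continuousAt_const.add hec)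
      have c2 : ContinuousAt
          (fun z : ι → ℝ => z i0 * Real.exp (w i (x + e z) - w i0 (x + e z))) y :=
        (continuousAt_apply i0 y).mul ((c1 i).sub (c1 i0)).rexp
      have hlt : y i < y i0 * Real.exp (w i (x + e y) - w i0 (x + e y)) := by
        rw [hy, PP_zero w x hi]
        exact mul_pos (PP_pos w x hi0) (Real.exp_pos _)
      filter_upwards [(continuousAt_apply i y).eventually_lt c2 hlt] with z hz _
      exact hz
  filter_upwards [E1, E2, E3] with z h1 h2 h3 Q' v f hf hz
  have hQQ : Q ⊆ Q' := by
    intro i hi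
    rw [PP_mem_iff w v, hz]
    exact (h1 i hi).ne'
  refine ⟨hQQ, x + e z, h2, ?_⟩
  have hLe : LL w Q i0 (e z) = LL w Q i0 (v - x) := by
    have : e z = G (LL w Q i0 (v - x)) := by
      simp only [e, hy, ← hz]
      rw [psi_PP w hi0 hQQ, psi_PP w hi0 (Finset.Subset.refl Q), map_sub (LL w Q i0)]
    rw [this, hG]
  have hQe : ∀ i ∈ Q, w i (v - x - e z) = w i0 (v - x - e z) := by
    intro i hi
    have := congrFun hLe i
    rw [LL_apply, LL_apply, if_pos hi, if_pos hi] at this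
    simp only [map_sub] at this ⊢
    linarith
  obtain ⟨t, ht⟩ := NN_push w ⟨i0, hi0⟩ hQQ hf (z := v - x - e z)
    (fun i hi j hj => by rw [hQe i hi, hQe j hj])
    (fun i hi j hj hj' => by
      rw [hQe i hi]
      have h4 := h3 j hj'
      rw [← hz, PP_ratio w v hj (hQQ hi0), hz] at h4
      have h5 := Real.exp_lt_exp.1 (lt_of_mul_lt_mul_left h4 (h1 i0 hi0).le)
      simp only [map_sub, map_add] at h5 ⊢
      linarith)
  exact ⟨_, ht, t, by abel⟩

theorem cont_nbhd {Q : Finset ι} (hQ : Q.Nonempty) {u f : A} (hf : f ∈ NN w Q)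
    {O : Set (ι → ℝ)} (hO : O ∈ 𝓝 (PP w Q u)) :
    ∃ (t : ℝ) (U : Set A), IsOpen U ∧ IsBounded U ∧ u + t • f ∈ U ∧
      ∀ Q' : Finset ι, Q ⊆ Q' → ∀ v ∈ U, ∀ g ∈ NN w Q, PP w Q' (v + g) ∈ O := by
  obtain ⟨i0, hi0⟩ := hQ
  let a : Finset ι → A → ι → ℝ := fun R v i => if i ∈ R then Real.exp (w i v - w i0 v) else 0
  let N : (ι → ℝ) → ι → ℝ := fun b i => b i / ∑ j, b j
  have hN : ∀ R : Finset ι, ∀ v, N (a R v) = PP w R v := by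
    intro R v
    funext i
    simp only [N, a, PP, Finset.sum_ite_mem, Finset.univ_inter]
    by_cases hi : i ∈ R
    · simp only [hi, if_true, Real.exp_sub]
      rw [← Finset.sum_div, div_div_div_cancel_right₀ (Real.exp_pos _).ne']
    · simp [hi]
  have hpos : 0 < ∑ j, a Q u j := by
    simp only [a, Finset.sum_ite_mem, Finset.univ_inter]
    exact Finset.sum_pos (fun _ _ => Real.exp_pos _) ⟨i0, hi0⟩
  have hNc : ContinuousAt N (a Q u) := by
    refine continuousAt_pi.2 fun i => ?_
    refine (continuousAt_apply i _).div ?_ hpos.ne'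
    exact (continuous_finsetSum _ fun j _ => continuous_apply j).continuousAt
  rw [← hN] at hO
  obtain ⟨δ, hδ, hball⟩ := Metric.mem_nhds_iff.1 (hNc hO)
  let b : A → ι → ℝ := fun v i => Real.exp (w i v - w i0 v)
  have hbc : Continuous b := continuous_pi fun i =>
    ((dual_cont (w i)).sub (dual_cont (w i0))).rexp
  have hbt : Tendsto (fun t : ℝ => b (u + t • f)) atTop (𝓝 (a Q u)) := by
    refine tendsto_pi_nhds.2 fun i => ?_
    simp only [b, a, map_add, map_smul, smul_eq_mul]
    by_cases hi : i ∈ Q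
    · simp only [hi, if_true, (hf i0 hi0).1 i hi]
      simp
    · simp only [hi, if_false]
      refine Real.tendsto_exp_atBot.comp ?_
      have hlt : w i f - w i0 f < 0 := by linarith [(hf i0 hi0).2 i hi]
      have := tendsto_atBot_add_const_left atTop (w i u - w i0 u)
        (tendsto_id.atTop_mul_const_of_neg hlt)
      refine this.congr fun t => ?_
      simp only [id]
      ring
  obtain ⟨t, ht⟩ := (hbt.eventually (Metric.ball_mem_nhds _ hδ)).exists
  refine ⟨t, Metric.ball (u + t • f) 1 ∩ b ⁻¹' Metric.ball (a Q u) δ,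
    Metric.isOpen_ball.inter (Metric.isOpen_ball.preimage hbc),
    Metric.isBounded_ball.subset Set.inter_subset_left,
    ⟨Metric.mem_ball_self one_pos, ht⟩, ?_⟩
  rintro Q' hQQ v ⟨-, hv⟩ g hg
  rw [← hN]
  refine hball ?_
  rw [Metric.mem_ball, dist_pi_lt_iff hδ]
  intro i
  have hvi := (dist_pi_lt_iff hδ).1 hv i
  by_cases hi : i ∈ Q
  · have e1 : a Q' (v + g) i = b v i := by
      simp only [a, b, hQQ hi, if_true, map_add, (hg i0 hi0).1 i hi]
      congr 1
      ring
    rw [e1]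
    exact hvi
  · have e1 : a Q u i = 0 := by simp [a, hi]
    have e2 : 0 ≤ a Q' (v + g) i := by
      simp only [a]; split_ifs <;> positivity
    have e3 : a Q' (v + g) i ≤ b v i := by
      simp only [a, b]
      split_ifs
      · apply Real.exp_le_exp.2
        have := (hg i0 hi0).2 i hi
        simp only [map_add]
        linarith
      · positivity
    rw [e1, Real.dist_eq, sub_zero] at hvi ⊢
    rw [abs_of_nonneg e2]
    exact e3.trans_lt (lt_of_abs_lt hvi)

theorem closed_aux {y : ι → ℝ} {R : Set (ι → ℝ)}
    (hR : ∀ z ∈ R, ∃ (Q : Finset ι) (v f : A), Q.Nonempty ∧ f ∈ NN w Q ∧ z = PP w Q v)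
    (hy : y ∈ closure R) :
    ∃ (Q : Finset ι) (v f : A), Q.Nonempty ∧ f ∈ NN w Q ∧ y = PP w Q v := by
  have hnn : ∀ i, 0 ≤ y i := by
    intro i
    refine closure_minimal (t := {z : ι → ℝ | 0 ≤ z i}) ?_
      (isClosed_le continuous_const (continuous_apply i)) hy
    intro z hz
    obtain ⟨Q, v, f, _, _, rfl⟩ := hR z hz
    exact PP_nonneg w Q v i
  have hsum : ∑ i, y i = 1 := by
    refine closure_minimal (t := {z : ι → ℝ | ∑ i, z i = 1}) ?_
      (isClosed_eq (continuous_finsetSum _ fun j _ => continuous_apply j) continuous_const) hy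
    intro z hz
    obtain ⟨Q, v, f, hQ, _, rfl⟩ := hR z hz
    exact PP_sum w hQ v
  let Q : Finset ι := Finset.univ.filter fun i => y i ≠ 0
  have hmem : ∀ i, i ∈ Q ↔ y i ≠ 0 := by simp [Q]
  have hQ : Q.Nonempty := by
    by_contra h
    rw [Finset.not_nonempty_iff_eq_empty] at h
    have : ∀ i, y i = 0 := by
      intro i
      by_contra hi
      have := (hmem i).2 hi
      simp [h] at this
    simp [this] at hsum
  obtain ⟨i0, hi0⟩ := hQ
  have hfr : ∃ᶠ z in 𝓝 y, z ∈ R := mem_closure_iff_frequently.1 hy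
  have hev : ∀ᶠ z in 𝓝 y, ∀ i, i ∈ Q → z i ≠ 0 := by
    rw [eventually_all]
    intro i
    by_cases hi : i ∈ Q
    · filter_upwards [(continuousAt_apply i y).eventually_ne ((hmem i).1 hi)] with z hz _
      exact hz
    · exact Filter.Eventually.of_forall fun z h => absurd h hi
  have hcl : psi Q i0 y ∈ closure (LinearMap.range (LL w Q i0) : Set (ι → ℝ)) := by
    refine mem_closure_of_frequently_of_tendsto ((hfr.and_eventually hev).mono ?_)
      (psi_cont hi0 fun i hi => (hmem i).1 hi)
    rintro z ⟨hz, hz'⟩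
    obtain ⟨Q', v, f, _, _, rfl⟩ := hR z hz
    have hQQ : Q ⊆ Q' := fun i hi => (PP_mem_iff w v).2 (hz' i hi)
    exact ⟨v, (psi_PP w hi0 hQQ v).symm⟩
  rw [(Submodule.closed_of_finiteDimensional (LinearMap.range (LL w Q i0))).closure_eq] at hcl
  obtain ⟨x, hx⟩ := hcl
  have hpos : ∀ i ∈ Q, 0 < y i := fun i hi => lt_of_le_of_ne (hnn i) ((hmem i).1 hi).symm
  have hyx : y = PP w Q x := by
    have h1 : ∀ i, y i = if i ∈ Q then y i0 * Real.exp (w i x - w i0 x) else 0 := by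
      intro i
      by_cases hi : i ∈ Q
      · have := congrFun hx i
        rw [LL_apply, psi, if_pos hi, if_pos hi] at this
        rw [if_pos hi, this, Real.exp_sub, Real.exp_log (hpos i hi), Real.exp_log (hpos i0 hi0)]
        have := (hpos i0 hi0).ne'
        field_simp
      · rw [if_neg hi]
        by_contra h
        exact hi ((hmem i).2 h)
    have h2 : y i0 * ∑ i ∈ Q, Real.exp (w i x - w i0 x) = 1 := by
      rw [← hsum, Finset.sum_congr rfl fun i _ => h1 i, Finset.sum_ite_mem, Finset.univ_inter,
        Finset.mul_sum]
    have h4 := PP_sum_pos w ⟨i0, hi0⟩ x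
    have h3 : y i0 = Real.exp (w i0 x) / ∑ j ∈ Q, Real.exp (w j x) := by
      simp only [Real.exp_sub] at h2
      rw [← Finset.sum_div] at h2
      have := (Real.exp_pos (w i0 x)).ne'
      rw [← mul_div_assoc, div_eq_one_iff_eq this] at h2
      rw [eq_div_iff h4.ne']
      exact h2
    funext i
    rw [h1 i, PP]
    split_ifs
    · rw [h3, Real.exp_sub, div_mul_div_comm, mul_comm (Real.exp (w i0 x)),
        mul_div_mul_right _ _ (Real.exp_pos (w i0 x)).ne']
    · rfl
  have hk := key_nbhd w ⟨i0, hi0⟩ (x := x) isOpen_univ (Set.mem_univ x)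
  rw [← hyx] at hk
  obtain ⟨z, hz, hz'⟩ := (hfr.and_eventually hk).exists
  obtain ⟨Q', v, f, _, hf, rfl⟩ := hR z hz
  obtain ⟨_, _, _, h, hh, _⟩ := hz' Q' v f hf rfl
  exact ⟨Q, x, h, ⟨i0, hi0⟩, hh, hyx⟩

end NormalFan

section Supports

variable {A : Type*} [NormedAddCommGroup A] [NormedSpace ℝ A] [FiniteDimensional ℝ A]

theorem coeffs_sum {Δ : Finset (Module.Dual ℝ A)} {μ : Module.Dual ℝ A}
    (h : ∃ n : Module.Dual ℝ A → ℝ, μ = ∑ b ∈ Δ, n b • b) :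
    μ = ∑ b ∈ Δ, coeffs Δ μ b • b := by
  unfold coeffs
  rw [dif_pos h]
  exact h.choose_spec

theorem coeffs_unique {Δ : Finset (Module.Dual ℝ A)}
    (hli : LinearIndependent ℝ (fun a : (Δ : Set (Module.Dual ℝ A)) => (a : Module.Dual ℝ A)))
    {μ : Module.Dual ℝ A} {n : Module.Dual ℝ A → ℝ} (h : μ = ∑ b ∈ Δ, n b • b) :
    ∀ b ∈ Δ, coeffs Δ μ b = n b := by
  have h1 := coeffs_sum ⟨n, h⟩
  have hli' : LinearIndepOn ℝ (id : Module.Dual ℝ A → Module.Dual ℝ A)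
    (Δ : Set (Module.Dual ℝ A)) := hli
  rw [linearIndepOn_finset_iff] at hli'
  intro b hb
  have := hli' (fun b => coeffs Δ μ b - n b) (by
    simp only [id, sub_smul, Finset.sum_sub_distrib]
    rw [← h1, ← h, sub_self]) b hb
  linarith

theorem exists_prescribed {Δ : Finset (Module.Dual ℝ A)}
    (hli : LinearIndependent ℝ (fun a : (Δ : Set (Module.Dual ℝ A)) => (a : Module.Dual ℝ A)))
    (c : Module.Dual ℝ A → ℝ) : ∃ x : A, ∀ a ∈ Δ, a x = c a := by
  have hli' : LinearIndepOn ℝ (id : Module.Dual ℝ A → Module.Dual ℝ A)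
    (Δ : Set (Module.Dual ℝ A)) := hli
  let B := Module.Basis.extend hli'
  let ψ : Module.Dual ℝ (Module.Dual ℝ A) := B.constr ℝ fun i => c i.1
  refine ⟨(Module.evalEquiv ℝ A).symm ψ, fun a ha => ?_⟩
  rw [Module.apply_evalEquiv_symm_apply]
  have hmem := hli'.subset_extend (Set.subset_univ _) ha
  have h1 : B ⟨a, hmem⟩ = a := Module.Basis.extend_apply_self hli' _
  have h2 := B.constr_basis ℝ (fun i => c i.1) ⟨a, hmem⟩
  rw [h1] at h2
  exact h2

theorem exit_step {D : Type*} {r : D → D → Prop} {p : D → Prop} {m n : D}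
    (h : Relation.ReflTransGen r m n) (hm : p m) (hn : ¬ p n) :
    ∃ c d, r c d ∧ p c ∧ ¬ p d := by
  induction h with
  | refl => exact absurd hm hn
  | tail _ hbc ih =>
    rename_i b c _
    by_cases hb : p b
    · exact ⟨b, c, hbc, hb, hn⟩
    · exact ih hb

theorem graphConnected_mono {D : Type*} {inn : D → D → ℝ} {M N : Set D} (h : M ⊆ N)
    (hM : GraphConnected inn M) {m n : D} (hm : m ∈ M) (hn : n ∈ M) :
    Relation.ReflTransGen (fun x y => x ∈ N ∧ y ∈ N ∧ inn x y ≠ 0) m n :=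
  Relation.ReflTransGen.mono (fun _ _ hxy => ⟨h hxy.1, h hxy.2.1, hxy.2.2⟩) _ _ (hM m hm n hn)

theorem graphConnected_insert {D : Type*} {inn : D → D → ℝ} (hs : ∀ x y, inn x y = inn y x)
    {M : Set D} (hM : GraphConnected inn M) {b c : D} (hc : c ∈ M) (hcb : inn c b ≠ 0) :
    GraphConnected inn (insert b M) := by
  have hbM : b ∈ insert b M := Set.mem_insert b M
  have hcM : c ∈ insert b M := Set.mem_insert_of_mem _ hc
  have s1 : Relation.ReflTransGen
      (fun x y => x ∈ insert b M ∧ y ∈ insert b M ∧ inn x y ≠ 0) c b :=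
    Relation.ReflTransGen.single ⟨hcM, hbM, hcb⟩
  have s2 : Relation.ReflTransGen
      (fun x y => x ∈ insert b M ∧ y ∈ insert b M ∧ inn x y ≠ 0) b c :=
    Relation.ReflTransGen.single ⟨hbM, hcM, by rwa [hs]⟩
  have sub := Set.subset_insert b M
  intro m hm n hn
  rcases hm with rfl | hm <;> rcases hn with rfl | hn
  · exact Relation.ReflTransGen.refl
  · exact s2.trans (graphConnected_mono sub hM hc hn)
  · exact (graphConnected_mono sub hM hm hc).trans s1
  · exact graphConnected_mono sub hM hm hn

end Supports

namespace RootWeightSystem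

variable {A : Type*} [NormedAddCommGroup A] [NormedSpace ℝ A] [FiniteDimensional ℝ A]
variable (S : RootWeightSystem A)

theorem diff_eq {Δ : Finset (Module.Dual ℝ A)} (hΔ : S.toRootWeightData.IsBase Δ)
    {l : Module.Dual ℝ A} (hl : l ∈ S.Λ) (x : A) :
    S.lam0 Δ x - l x = ∑ b ∈ Δ, coeffs Δ (S.lam0 Δ - l) b * b x := by
  obtain ⟨n, _, hn⟩ := S.lam0_dominates Δ hΔ l hl
  have := LinearMap.congr_fun (coeffs_sum ⟨n, hn⟩) x
  simpa [LinearMap.sum_apply] using this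

theorem coeffs_nonneg {Δ : Finset (Module.Dual ℝ A)} (hΔ : S.toRootWeightData.IsBase Δ)
    {l : Module.Dual ℝ A} (hl : l ∈ S.Λ) {b : Module.Dual ℝ A} (hb : b ∈ Δ) :
    0 ≤ coeffs Δ (S.lam0 Δ - l) b := by
  obtain ⟨n, hn0, hn⟩ := S.lam0_dominates Δ hΔ l hl
  rw [coeffs_unique hΔ.2.1 hn b hb]
  exact hn0 b hb

theorem supp_lam0 {Δ : Finset (Module.Dual ℝ A)} (hΔ : S.toRootWeightData.IsBase Δ) :
    supp Δ (S.lam0 Δ - S.lam0 Δ) = ∅ := by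
  ext b
  simp only [supp, Finset.mem_filter, Finset.notMem_empty, iff_false, not_and, not_not]
  intro hb
  exact coeffs_unique hΔ.2.1 (n := fun _ => 0) (by simp) b hb

theorem diff_zero {Δ : Finset (Module.Dual ℝ A)} (hΔ : S.toRootWeightData.IsBase Δ)
    {l : Module.Dual ℝ A} (hl : l ∈ S.Λ) {Y : Finset (Module.Dual ℝ A)}
    (hY : supp Δ (S.lam0 Δ - l) ⊆ Y) {x : A} (hx : ∀ a ∈ Y, a x = 0) :
    S.lam0 Δ x - l x = 0 := by
  rw [S.diff_eq hΔ hl]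
  refine Finset.sum_eq_zero fun b hb => ?_
  by_cases h : coeffs Δ (S.lam0 Δ - l) b = 0
  · simp [h]
  · rw [hx b (hY (Finset.mem_filter.2 ⟨hb, h⟩)), mul_zero]

/-- The weights whose difference to the highest weight is supported in `Y`. -/
def QY (Δ Y : Finset (Module.Dual ℝ A)) : Finset S.Λ :=
  Finset.univ.filter fun l => supp Δ (S.lam0 Δ - l.1) ⊆ Y

theorem mem_QY {Δ Y : Finset (Module.Dual ℝ A)} {l : S.Λ} :
    l ∈ S.QY Δ Y ↔ supp Δ (S.lam0 Δ - l.1) ⊆ Y := by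
  simp [QY]

/-- The weights as a family. -/
abbrev wt : S.Λ → Module.Dual ℝ A := Subtype.val

theorem vanish_of_argmax {Δ Y : Finset (Module.Dual ℝ A)} (hΔ : S.toRootWeightData.IsBase Δ)
    (hY : S.toRootWeightData.Admissible Δ Y) {x : A}
    (hx : ∀ l ∈ S.Λ, supp Δ (S.lam0 Δ - l) ⊆ Y → S.lam0 Δ x - l x = 0) :
    ∀ a ∈ Y, a x = 0 := by
  let fam := Y.powerset.filter fun C => S.toRootWeightData.Admissible Δ C ∧ ∀ a ∈ C, a x = 0
  have hfam : ∀ C, C ∈ fam ↔ C ⊆ Y ∧ S.toRootWeightData.Admissible Δ C ∧ ∀ a ∈ C, a x = 0 := by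
    intro C; simp [fam]
  have hempty : (∅ : Finset (Module.Dual ℝ A)) ∈ fam := by
    rw [hfam]
    refine ⟨by simp, ⟨by simp, ?_⟩, by simp⟩
    intro m hm n hn
    simp at hm hn
    rw [hm, hn]
  obtain ⟨C, hC, hmax⟩ := Finset.exists_max_image fam Finset.card ⟨∅, hempty⟩
  obtain ⟨hCY, hCa, hC0⟩ := (hfam C).1 hC
  by_contra hcon
  push Not at hcon
  obtain ⟨b, hbY, hbx⟩ := hcon
  have hbC : b ∉ C := fun h => hbx (hC0 b h)
  have hex : ∃ d ∈ Y, d ∉ C ∧ S.toRootWeightData.Admissible Δ (insert d C) := by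
    by_cases hb0 : b = S.lam0 Δ
    · refine ⟨b, hbY, hbC, Finset.insert_subset (hY.1 hbY) hCa.1, ?_⟩
      have : ((insert b C : Finset (Module.Dual ℝ A)) : Set (Module.Dual ℝ A)) ∪ {S.lam0 Δ}
          = (C : Set (Module.Dual ℝ A)) ∪ {S.lam0 Δ} := by
        ext z; simp [hb0]
      rw [this]
      exact hCa.2
    · have hpath := hY.2 (S.lam0 Δ) (by simp) b (by simp [hbY])
      obtain ⟨c, d, ⟨_, hd, hcd⟩, hc', hd'⟩ := exit_step
        (p := fun z => z ∈ (C : Set (Module.Dual ℝ A)) ∪ {S.lam0 Δ}) hpath (by simp)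
        (by simp [hbC, hb0])
      have hd1 : d ∉ C := fun h => hd' (Or.inl h)
      have hd2 : d ≠ S.lam0 Δ := fun h => hd' (Or.inr h)
      have hdY : d ∈ Y := by
        rcases hd with h | h
        · exact h
        · exact absurd h hd2
      refine ⟨d, hdY, hd1, Finset.insert_subset (hY.1 hdY) hCa.1, ?_⟩
      have := graphConnected_insert S.inn_symm hCa.2 hc' hcd
      rwa [← Set.insert_union, ← Finset.coe_insert] at this
  obtain ⟨d, hdY, hdC, hadm⟩ := hex
  have hsubY : insert d C ⊆ Y := Finset.insert_subset hdY hCY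
  obtain ⟨l, hl, hsupp⟩ := (S.admissible_iff_support Δ hΔ _ hadm.1).1 hadm
  have h0 := hx l hl (hsupp ▸ hsubY)
  have hdsupp : d ∈ supp Δ (S.lam0 Δ - l) := by rw [hsupp]; simp
  obtain ⟨hdΔ, hdne⟩ := Finset.mem_filter.1 hdsupp
  rw [S.diff_eq hΔ hl, Finset.sum_eq_single d] at h0
  · have hdx : d x = 0 := (mul_eq_zero.1 h0).resolve_left hdne
    have hin : insert d C ∈ fam := by
      rw [hfam]
      refine ⟨hsubY, hadm, ?_⟩
      intro a ha
      rcases Finset.mem_insert.1 ha with rfl | ha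
      · exact hdx
      · exact hC0 a ha
    have := hmax _ hin
    rw [Finset.card_insert_of_notMem hdC] at this
    omega
  · intro a ha had
    by_cases h : coeffs Δ (S.lam0 Δ - l) a = 0
    · simp [h]
    · have : a ∈ supp Δ (S.lam0 Δ - l) := Finset.mem_filter.2 ⟨ha, h⟩
      rw [hsupp] at this
      rw [hC0 a ((Finset.mem_insert.1 this).resolve_left had), mul_zero]
  · exact fun h => absurd hdΔ h

theorem lam0_mem_QY {Δ : Finset (Module.Dual ℝ A)} (hΔ : S.toRootWeightData.IsBase Δ)
    (Y : Finset (Module.Dual ℝ A)) : (⟨S.lam0 Δ, S.lam0_mem Δ hΔ⟩ : S.Λ) ∈ S.QY Δ Y := by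
  rw [mem_QY, S.supp_lam0 hΔ]
  simp

theorem face_eq {Δ Y : Finset (Module.Dual ℝ A)} (hΔ : S.toRootWeightData.IsBase Δ)
    (hY : S.toRootWeightData.Admissible Δ Y) : S.Face Δ Y = NN S.wt (S.QY Δ Y) := by
  have h0 := S.lam0_mem_QY hΔ Y
  ext x
  constructor
  · rintro ⟨h1, h2⟩
    have hz : ∀ i ∈ S.QY Δ Y, i.1 x = S.lam0 Δ x := by
      intro i hi
      have := S.diff_zero hΔ i.2 (S.mem_QY.1 hi) h1
      linarith
    intro i hi
    refine ⟨fun j hj => by rw [hz i hi, hz j hj], fun j hj => ?_⟩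
    rw [hz i hi]
    have := h2 j.1 j.2 (fun h => hj (S.mem_QY.2 h))
    rw [LinearMap.sub_apply] at this
    linarith
  · intro h
    refine ⟨S.vanish_of_argmax hΔ hY ?_, ?_⟩
    · intro l hl hs
      have hm : (⟨l, hl⟩ : S.Λ) ∈ S.QY Δ Y := S.mem_QY.2 hs
      have : l x = S.lam0 Δ x := (h _ h0).1 ⟨l, hl⟩ hm
      linarith
    · intro l hl hs
      have hm : (⟨l, hl⟩ : S.Λ) ∉ S.QY Δ Y := fun h' => hs ((S.mem_QY (l := ⟨l, hl⟩)).1 h')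
      have : l x < S.lam0 Δ x := (h _ h0).2 ⟨l, hl⟩ hm
      rw [LinearMap.sub_apply]
      linarith

theorem face_nonempty {Δ Y : Finset (Module.Dual ℝ A)} (hΔ : S.toRootWeightData.IsBase Δ)
    (hYΔ : Y ⊆ Δ) : (S.Face Δ Y).Nonempty := by
  obtain ⟨x, hx⟩ := exists_prescribed hΔ.2.1 (fun a => if a ∈ Y then 0 else 1)
  refine ⟨x, ?_, ?_⟩
  · intro a ha
    rw [hx a (hYΔ ha), if_pos ha]
  · intro l hl hns
    rw [LinearMap.sub_apply, S.diff_eq hΔ hl]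
    obtain ⟨a, ha, haY⟩ := Finset.not_subset.1 hns
    obtain ⟨haΔ, hane⟩ := Finset.mem_filter.1 ha
    refine Finset.sum_pos' (fun b hb => mul_nonneg (S.coeffs_nonneg hΔ hl hb) ?_) ⟨a, haΔ, ?_⟩
    · rw [hx b hb]
      split_ifs <;> norm_num
    · rw [hx a haΔ, if_neg haY, mul_one]
      exact lt_of_le_of_ne (S.coeffs_nonneg hΔ hl haΔ) hane.symm

theorem exists_face (x : A) : ∃ F : Set A, S.IsFace F ∧ x ∈ F := by
  obtain ⟨Δ, hΔ, hpos⟩ := S.base_cover x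
  have hterm : ∀ l ∈ S.Λ, ∀ b ∈ Δ, 0 ≤ coeffs Δ (S.lam0 Δ - l) b * b x := fun l hl b hb =>
    mul_nonneg (S.coeffs_nonneg hΔ hl hb) (hpos b hb)
  let Y := (S.Λ.filter fun l => S.lam0 Δ x - l x = 0).biUnion fun l => supp Δ (S.lam0 Δ - l)
  have hYm : ∀ a, a ∈ Y ↔ ∃ l ∈ S.Λ, S.lam0 Δ x - l x = 0 ∧ a ∈ supp Δ (S.lam0 Δ - l) := by
    intro a; simp only [Y, Finset.mem_biUnion, Finset.mem_filter, and_assoc]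
  have hcon : ∀ l ∈ S.Λ,
      GraphConnected S.inn ((supp Δ (S.lam0 Δ - l) : Set (Module.Dual ℝ A)) ∪ {S.lam0 Δ}) :=
    fun l hl => ((S.admissible_iff_support Δ hΔ _ (Finset.filter_subset _ _)).2 ⟨l, hl, rfl⟩).2
  have hloc : ∀ m ∈ (Y : Set (Module.Dual ℝ A)) ∪ {S.lam0 Δ}, ∃ l ∈ S.Λ,
      S.lam0 Δ x - l x = 0 ∧ m ∈ (supp Δ (S.lam0 Δ - l) : Set (Module.Dual ℝ A)) ∪ {S.lam0 Δ} := by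
    rintro m (hm | hm)
    · obtain ⟨l, hl, h1, h2⟩ := (hYm m).1 hm
      exact ⟨l, hl, h1, Or.inl h2⟩
    · exact ⟨S.lam0 Δ, S.lam0_mem Δ hΔ, sub_self _, Or.inr hm⟩
  have hsub : ∀ l ∈ S.Λ, S.lam0 Δ x - l x = 0 →
      (supp Δ (S.lam0 Δ - l) : Set (Module.Dual ℝ A)) ∪ {S.lam0 Δ} ⊆
        (Y : Set (Module.Dual ℝ A)) ∪ {S.lam0 Δ} := by
    intro l hl h0
    refine Set.union_subset_union_left _ fun a ha => ?_
    exact (hYm a).2 ⟨l, hl, h0, ha⟩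
  refine ⟨S.Face Δ Y, ⟨Δ, Y, hΔ, ⟨?_, ?_⟩, rfl⟩, ?_, ?_⟩
  · intro a ha
    obtain ⟨l, _, _, h2⟩ := (hYm a).1 ha
    exact (Finset.mem_filter.1 h2).1
  · intro m hm n hn
    obtain ⟨l, hl, h0, hml⟩ := hloc m hm
    obtain ⟨k, hk, hk0, hnk⟩ := hloc n hn
    exact (graphConnected_mono (hsub l hl h0) (hcon l hl) hml (Or.inr rfl)).trans
      (graphConnected_mono (hsub k hk hk0) (hcon k hk) (Or.inr rfl) hnk)
  · intro a ha
    obtain ⟨l, hl, h0, h2⟩ := (hYm a).1 ha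
    obtain ⟨haΔ, hane⟩ := Finset.mem_filter.1 h2
    rw [S.diff_eq hΔ hl, Finset.sum_eq_zero_iff_of_nonneg (hterm l hl)] at h0
    exact (mul_eq_zero.1 (h0 a haΔ)).resolve_left hane
  · intro l hl hns
    rw [LinearMap.sub_apply]
    refine lt_of_le_of_ne ?_ fun h => hns fun a ha => (hYm a).2 ⟨l, hl, h.symm, ha⟩
    rw [S.diff_eq hΔ hl]
    exact Finset.sum_nonneg (hterm l hl)

theorem face_form (F : S.Faces) :
    ∃ Q : Finset S.Λ, Q.Nonempty ∧ (NN S.wt Q).Nonempty ∧ F.val = NN S.wt Q := by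
  obtain ⟨F, Δ, Y, hΔ, hY, rfl⟩ := F
  refine ⟨S.QY Δ Y, ⟨_, S.lam0_mem_QY hΔ Y⟩, ?_, S.face_eq hΔ hY⟩
  rw [← S.face_eq hΔ hY]
  exact S.face_nonempty hΔ hY.1

/-- The index set of a face. -/
def QF (F : S.Faces) : Finset S.Λ := (S.face_form F).choose

theorem QF_nonempty (F : S.Faces) : (S.QF F).Nonempty := (S.face_form F).choose_spec.1

theorem QF_NN (F : S.Faces) : (NN S.wt (S.QF F)).Nonempty := (S.face_form F).choose_spec.2.1

theorem QF_eq (F : S.Faces) : F.val = NN S.wt (S.QF F) := (S.face_form F).choose_spec.2.2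

theorem exists_QF {Q : Finset S.Λ} (hQ : Q.Nonempty) {x : A} (hx : x ∈ NN S.wt Q) :
    ∃ F : S.Faces, S.QF F = Q := by
  obtain ⟨F, hF, hxF⟩ := S.exists_face x
  refine ⟨⟨F, hF⟩, ?_⟩
  have h := S.QF_eq ⟨F, hF⟩
  have hx' : x ∈ NN S.wt (S.QF ⟨F, hF⟩) := by rw [← h]; exact hxF
  exact NN_unique S.wt (S.QF_nonempty _) hQ hx' hx

theorem span_iff (F : S.Faces) (z : A) : z ∈ Submodule.span ℝ F.val ↔
    ∀ i ∈ S.QF F, ∀ j ∈ S.QF F, S.wt j z = S.wt i z := by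
  rw [S.QF_eq F]
  exact NN_span S.wt (S.QF_nonempty F) (S.QF_NN F) z

theorem closure_iff (F F' : S.Faces) : F'.val ⊆ closure F.val ↔ S.QF F ⊆ S.QF F' := by
  rw [S.QF_eq F, S.QF_eq F']
  exact NN_closure S.wt (S.QF_nonempty F') (S.QF_NN F) (S.QF_NN F')

theorem mkAbar_eq {F : S.Faces} {u v : A} (h : u - v ∈ Submodule.span ℝ F.val) :
    S.mkAbar F u = S.mkAbar F v := Quot.sound ⟨rfl, h⟩

/-- The embedding of `Ā` in a simplex. -/
def emb : S.Abar → (S.Λ → ℝ) :=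
  Quot.lift (fun p => PP S.wt (S.QF p.1) p.2) (by
    rintro ⟨F, u⟩ ⟨F', v⟩ ⟨h1, h2⟩
    simp only at h1 h2
    subst h1
    exact PP_congr S.wt fun i hi j hj => (S.span_iff F _).1 h2 j hj i hi)

theorem emb_mk (F : S.Faces) (u : A) : S.emb (S.mkAbar F u) = PP S.wt (S.QF F) u := rfl

theorem exists_mk (p : S.Abar) : ∃ F u, p = S.mkAbar F u := by
  induction p using Quot.ind with
  | mk p => exact ⟨p.1, p.2, rfl⟩

theorem emb_injective : Function.Injective S.emb := by
  intro p q h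
  obtain ⟨F, u, rfl⟩ := S.exists_mk p
  obtain ⟨F', v, rfl⟩ := S.exists_mk q
  rw [emb_mk, emb_mk] at h
  have hQ : S.QF F = S.QF F' := by
    ext i
    rw [PP_mem_iff S.wt u, PP_mem_iff S.wt v, h]
  have hF : F = F' := Subtype.ext (by rw [S.QF_eq F, S.QF_eq F', hQ])
  subst hF
  refine S.mkAbar_eq ((S.span_iff F _).2 fun i hi j hj => ?_)
  have h1 := PP_log S.wt u hi hj
  have h2 := PP_log S.wt v hi hj
  rw [h] at h1
  rw [map_sub, map_sub]
  linarith

theorem emb_continuous : Continuous S.emb := by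
  rw [continuous_iff_continuousAt]
  intro p
  obtain ⟨F, u, rfl⟩ := S.exists_mk p
  intro O hO
  rw [emb_mk] at hO
  obtain ⟨f, hf⟩ := S.QF_NN F
  obtain ⟨t, U, hUo, hUb, hmem, hU⟩ := cont_nbhd S.wt (S.QF_nonempty F) hf hO
  have hfF : f ∈ F.val := by rw [S.QF_eq F]; exact hf
  have hopen : IsOpen (S.Gamma F U) :=
    TopologicalSpace.isOpen_generateFrom_of_mem ⟨F, U, hUo, hUb, rfl⟩
  have hp : S.mkAbar F u ∈ S.Gamma F U := by
    refine ⟨F, subset_closure, (u + t • f) + f, Set.add_mem_add hmem hfF, S.mkAbar_eq ?_⟩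
    have h1 := Submodule.subset_span (R := ℝ) hfF
    have h2 := Submodule.neg_mem _ (Submodule.add_mem _ (Submodule.smul_mem _ t h1) h1)
    convert h2 using 1
    abel
  refine mem_map.2 (Filter.mem_of_superset (hopen.mem_nhds hp) ?_)
  rintro q ⟨F', hF', _, ⟨v, hv, g, hg, rfl⟩, rfl⟩
  rw [S.QF_eq F] at hg
  exact hU _ ((S.closure_iff F F').1 hF') v hv g hg

theorem emb_inducing : IsInducing S.emb := by
  refine ⟨le_antisymm (continuous_iff_le_induced.1 S.emb_continuous) ?_⟩
  refine le_generateFrom ?_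
  rintro V ⟨F, U, hUo, hUb, rfl⟩
  rw [@isOpen_iff_mem_nhds]
  rintro p ⟨F', hF', x, hx, rfl⟩
  rw [nhds_induced]
  have hk := key_nbhd S.wt (S.QF_nonempty F') (hUo.add_right (t := F.val)) hx
  refine Filter.mem_comap.2 ⟨_, hk, ?_⟩
  intro q hq
  obtain ⟨F'', v, rfl⟩ := S.exists_mk q
  obtain ⟨f, hf⟩ := S.QF_NN F''
  obtain ⟨hQ, y, ⟨u, hu, g, hg, hy⟩, h, hh, t, ht⟩ := hq (S.QF F'') v f hf rfl
  have hQ' := (S.closure_iff F F').1 hF'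
  refine ⟨F'', (S.closure_iff F F'').2 (hQ'.trans hQ), v + t • f, ?_, S.mkAbar_eq ?_⟩
  · rw [ht]
    refine ⟨u, hu, g + h, ?_, ?_⟩
    · rw [S.QF_eq F] at hg ⊢
      exact NN_add S.wt hQ' hg hh
    · rw [← hy]
      simp only
      abel
  · have hfF : f ∈ F''.val := by rw [S.QF_eq F'']; exact hf
    have h2 := Submodule.neg_mem _ (Submodule.smul_mem _ t (Submodule.subset_span (R := ℝ) hfF))
    convert h2 using 1
    abel

theorem emb_range_compact : IsCompact (Set.range S.emb) := by
  have hform : ∀ z ∈ Set.range S.emb, ∃ (Q : Finset S.Λ) (v f : A),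
      Q.Nonempty ∧ f ∈ NN S.wt Q ∧ z = PP S.wt Q v := by
    rintro _ ⟨p, rfl⟩
    obtain ⟨F, u, rfl⟩ := S.exists_mk p
    obtain ⟨f, hf⟩ := S.QF_NN F
    exact ⟨S.QF F, u, f, S.QF_nonempty F, hf, rfl⟩
  have hclosed : IsClosed (Set.range S.emb) := by
    refine isClosed_of_closure_subset fun y hy => ?_
    obtain ⟨Q, v, f, hQ, hf, rfl⟩ := closed_aux S.wt hform hy
    obtain ⟨F, rfl⟩ := S.exists_QF hQ hf
    exact ⟨S.mkAbar F v, rfl⟩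
  refine (isCompact_Icc (a := (0 : S.Λ → ℝ)) (b := 1)).of_isClosed_subset hclosed ?_
  intro z hz
  obtain ⟨Q, v, f, hQ, hf, rfl⟩ := hform z hz
  refine ⟨fun i => PP_nonneg S.wt Q v i, fun i => ?_⟩
  have := PP_sum S.wt hQ v
  rw [Pi.one_apply, ← this]
  exact Finset.single_le_sum (fun j _ => PP_nonneg S.wt Q v j) (Finset.mem_univ i)

end RootWeightSystem

variable {A : Type*} [NormedAddCommGroup A] [NormedSpace ℝ A] [FiniteDimensional ℝ A]

/-- The topological space `Ā` is compact Hausdorff (and second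
countable). -/
theorem abar_compactSpace (S : RootWeightSystem A) :
    CompactSpace S.Abar ∧ T2Space S.Abar ∧
      SecondCountableTopology S.Abar := by
  have hemb : IsEmbedding S.emb := ⟨S.emb_inducing, S.emb_injective⟩
  refine ⟨⟨?_⟩, hemb.t2Space, hemb.secondCountableTopology⟩
  rw [S.emb_inducing.isCompact_iff, Set.image_univ]
  exact S.emb_range_compact
end
end

section
/- Assume that for some (equivalently, by W-equivariance, for every) basis Δ of Φ the highest weights λ₀^ρ(Δ) and λ₀^σ(Δ) lie in the same face of the decomposition of A* determined by the hyperplanes H_a = {z ∈ A* : (a, z) = 0}, a ∈ Φ. Then for every basis Δ of Φ a subset Y ⊆ Δ is admissible with respect to ρ if and only if it is admissible with respect to σ, and for every such admissible Y one has F_Y^Δ(ρ) = F_Y^Δ(σ); in particular, ρ and σ give rise to the same decomposition of A into faces. -/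
/-!
Common setup for Werner, "Compactifications of Bruhat-Tits buildings associated to
linear representations":  a finite-dimensional real vector space `A` (the apartment),
a root system `Φ` in the dual space together with a Weyl-group invariant inner
product, a finite Weyl-invariant set `Λ` of (K-)weights, and for every basis `Δ`
of `Φ` a highest weight `lam0 Δ ∈ Λ`.
-/

open Pointwise Filter Topology Bornology
open scoped Classical

noncomputable section

variable {A : Type*} [NormedAddCommGroup A] [NormedSpace ℝ A] [FiniteDimensional ℝ A]

section Helpers

/-- `μ` is a nonnegative combination of the elements of `Δ`. -/
def InCone (Δ : Finset (Module.Dual ℝ A)) (μ : Module.Dual ℝ A) : Prop :=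
  ∃ n : Module.Dual ℝ A → ℝ, (∀ b ∈ Δ, 0 ≤ n b) ∧ μ = ∑ b ∈ Δ, n b • b

lemma InCone.zero (Δ : Finset (Module.Dual ℝ A)) : InCone Δ 0 :=
  ⟨fun _ => 0, fun _ _ => le_rfl, by simp⟩

lemma InCone.add {Δ : Finset (Module.Dual ℝ A)} {μ ν : Module.Dual ℝ A}
    (h : InCone Δ μ) (h' : InCone Δ ν) : InCone Δ (μ + ν) := by
  obtain ⟨n, hn, rfl⟩ := h
  obtain ⟨m, hm, rfl⟩ := h'
  refine ⟨fun b => n b + m b, fun b hb => add_nonneg (hn b hb) (hm b hb), ?_⟩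
  simp [add_smul, Finset.sum_add_distrib]

lemma InCone.smul {Δ : Finset (Module.Dual ℝ A)} {μ : Module.Dual ℝ A} {c : ℝ} (hc : 0 ≤ c)
    (h : InCone Δ μ) : InCone Δ (c • μ) := by
  obtain ⟨n, hn, rfl⟩ := h
  refine ⟨fun b => c * n b, fun b hb => mul_nonneg hc (hn b hb), ?_⟩
  simp [mul_smul, Finset.smul_sum]

lemma InCone.of_mem {Δ : Finset (Module.Dual ℝ A)} {b : Module.Dual ℝ A} (hb : b ∈ Δ) :
    InCone Δ b := by
  refine ⟨fun c => if c = b then 1 else 0, fun c _ => by dsimp only; split_ifs <;> norm_num, ?_⟩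
  simp [hb]

lemma InCone.map {Δ Δ' : Finset (Module.Dual ℝ A)} {μ : Module.Dual ℝ A}
    (f : Module.Dual ℝ A →ₗ[ℝ] Module.Dual ℝ A) (hf : ∀ b ∈ Δ, InCone Δ' (f b))
    (h : InCone Δ μ) : InCone Δ' (f μ) := by
  obtain ⟨n, hn, rfl⟩ := h
  rw [map_sum]
  refine Finset.sum_induction _ (InCone Δ') (fun _ _ => InCone.add) (InCone.zero _) ?_
  intro b hb
  rw [map_smul]
  exact (hf b hb).smul (hn b hb)

namespace RootWeightSystem

lemma li {S : RootWeightSystem A} {Δ : Finset (Module.Dual ℝ A)}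
    (hB : S.toRootWeightData.IsBase Δ) {f g : Module.Dual ℝ A → ℝ}
    (h : ∑ b ∈ Δ, f b • b = ∑ b ∈ Δ, g b • b) : ∀ b ∈ Δ, f b = g b := by
  have h1 : LinearIndepOn ℝ id (Δ : Set (Module.Dual ℝ A)) := hB.2.1
  exact linearIndepOn_finset_iffₛ.1 h1 f g h

lemma coeffs_eq {S : RootWeightSystem A} {Δ : Finset (Module.Dual ℝ A)}
    (hB : S.toRootWeightData.IsBase Δ) {μ : Module.Dual ℝ A} {f : Module.Dual ℝ A → ℝ}
    (h : μ = ∑ b ∈ Δ, f b • b) : ∀ b ∈ Δ, coeffs Δ μ b = f b := by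
  have hex : ∃ n : Module.Dual ℝ A → ℝ, μ = ∑ b ∈ Δ, n b • b := ⟨f, h⟩
  unfold coeffs
  rw [dif_pos hex]
  exact li hB (hex.choose_spec.symm.trans h)

lemma cone_antisymm {S : RootWeightSystem A} {Δ : Finset (Module.Dual ℝ A)}
    (hB : S.toRootWeightData.IsBase Δ) {μ : Module.Dual ℝ A}
    (h : InCone Δ μ) (h' : InCone Δ (-μ)) : μ = 0 := by
  obtain ⟨n, hn, e⟩ := h
  obtain ⟨m, hm, e'⟩ := h'
  have : ∑ b ∈ Δ, (n b + m b) • b = ∑ b ∈ Δ, (fun _ => (0:ℝ)) b • b := by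
    simp only [add_smul, Finset.sum_add_distrib, ← e, ← e']
    simp
  have h0 := li hB this
  rw [e]
  refine Finset.sum_eq_zero fun b hb => ?_
  have := h0 b hb
  have h1 := hn b hb
  have h2 := hm b hb
  rw [show n b = 0 by linarith, zero_smul]

lemma supp_subset_of_mem_span {S : RootWeightSystem A} {Δ Y : Finset (Module.Dual ℝ A)}
    (hB : S.toRootWeightData.IsBase Δ) (hY : Y ⊆ Δ) {μ : Module.Dual ℝ A}
    (h : μ ∈ Submodule.span ℝ (Y : Set (Module.Dual ℝ A))) : supp Δ μ ⊆ Y := by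
  obtain ⟨f, -, hf⟩ := Submodule.mem_span_finset.1 h
  have e : μ = ∑ b ∈ Δ, (fun b => if b ∈ Y then f b else 0) b • b := by
    rw [← hf]
    rw [← Finset.sum_subset hY (f := fun b => (if b ∈ Y then f b else 0) • b)]
    · exact Finset.sum_congr rfl fun b hb => by simp [hb]
    · intro b _ hb
      simp [hb]
  intro b hb
  obtain ⟨hbΔ, hb⟩ := Finset.mem_filter.1 hb
  rw [coeffs_eq hB e b hbΔ] at hb
  by_contra hc
  simp [hc] at hb

lemma eq_sum_coeffs {S : RootWeightSystem A} {Δ : Finset (Module.Dual ℝ A)}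
    (hB : S.toRootWeightData.IsBase Δ) {μ : Module.Dual ℝ A} (h : InCone Δ μ) :
    (∀ b ∈ Δ, 0 ≤ coeffs Δ μ b) ∧ μ = ∑ b ∈ supp Δ μ, coeffs Δ μ b • b := by
  obtain ⟨n, hn, e⟩ := h
  have hc := coeffs_eq hB e
  refine ⟨fun b hb => by rw [hc b hb]; exact hn b hb, ?_⟩
  have hs : ∑ b ∈ supp Δ μ, coeffs Δ μ b • b = ∑ b ∈ Δ, coeffs Δ μ b • b := by
    refine Finset.sum_subset (Finset.filter_subset _ _) fun b hb hb' => ?_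
    have : coeffs Δ μ b = 0 := by
      by_contra hne
      exact hb' (Finset.mem_filter.2 ⟨hb, hne⟩)
    rw [this, zero_smul]
  rw [hs, Finset.sum_congr rfl fun b hb => by rw [hc b hb]]
  exact e

lemma exists_pos {S : RootWeightSystem A} {Δ : Finset (Module.Dual ℝ A)}
    (hB : S.toRootWeightData.IsBase Δ) : ∃ y : A, ∀ b ∈ Δ, b y = 1 := by
  have hli : LinearIndependent ℝ
      (fun a : (Δ : Set (Module.Dual ℝ A)) => (a : Module.Dual ℝ A)) := hB.2.1
  let bs := Module.Basis.span hli
  obtain ⟨g, hg⟩ := (bs.constr ℝ (fun _ => (1:ℝ))).exists_extend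
  refine ⟨(Module.evalEquiv ℝ A).symm g, fun b hb => ?_⟩
  rw [Module.apply_evalEquiv_symm_apply]
  have h1 : bs.constr ℝ (fun _ => (1:ℝ)) (bs ⟨b, hb⟩) = 1 := by simp
  rw [← hg] at h1
  have h2 : ((bs ⟨b, hb⟩ : _) : Module.Dual ℝ A) = b := by
    simp [bs, Module.Basis.span_apply]
  simpa [h2] using h1

lemma exists_eps (F : Finset (Module.Dual ℝ A)) (x y : A) :
    ∃ ε : ℝ, 0 < ε ∧ ∀ v ∈ F, 0 < v x → 0 < v (x + ε • y) := by
  have : ∀ᶠ ε : ℝ in 𝓝[>] 0, ∀ v ∈ F, 0 < v x → 0 < v (x + ε • y) := by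
    rw [Filter.eventually_all_finset]
    intro v _
    by_cases hv : 0 < v x
    · have hc : Continuous fun ε : ℝ => v (x + ε • y) := by
        simp only [map_add, map_smul, smul_eq_mul]
        fun_prop
      have h0 : ∀ᶠ ε : ℝ in 𝓝 0, 0 < v (x + ε • y) :=
        hc.continuousAt.eventually_const_lt (by simpa using hv)
      exact (h0.filter_mono nhdsWithin_le_nhds).mono fun ε h _ => h
    · exact Eventually.of_forall fun ε h => absurd h hv
  obtain ⟨ε, h1, h2⟩ := (this.and self_mem_nhdsWithin).exists
  exact ⟨ε, h2, h1⟩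

variable (S : RootWeightSystem A)

/-- The inner product as a linear form in the first variable. -/
def innL (y : Module.Dual ℝ A) : Module.Dual ℝ A →ₗ[ℝ] ℝ where
  toFun x := S.inn x y
  map_add' x x' := S.inn_add_left x x' y
  map_smul' c x := S.inn_smul_left c x y

lemma inn_sub_left (x x' y : Module.Dual ℝ A) : S.inn (x - x') y = S.inn x y - S.inn x' y :=
  (S.innL y).map_sub x x'

lemma inn_add_right (y x x' : Module.Dual ℝ A) : S.inn y (x + x') = S.inn y x + S.inn y x' := by
  rw [S.inn_symm, S.inn_add_left, S.inn_symm x, S.inn_symm x']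

lemma inn_smul_right (c : ℝ) (y x : Module.Dual ℝ A) : S.inn y (c • x) = c * S.inn y x := by
  rw [S.inn_symm, S.inn_smul_left, S.inn_symm x]

/-- The reflection as a linear map. -/
def reflL (a : Module.Dual ℝ A) : Module.Dual ℝ A →ₗ[ℝ] Module.Dual ℝ A where
  toFun := S.toRootWeightData.refl a
  map_add' x y := by
    simp only [RootWeightData.refl, S.inn_add_left, mul_add, add_div, add_smul]
    abel
  map_smul' c x := by
    simp only [RootWeightData.refl, S.inn_smul_left, RingHom.id_apply, smul_sub, smul_smul]
    congr 2
    ring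

lemma refl_apply (a x : Module.Dual ℝ A) :
    S.toRootWeightData.refl a x = x - (2 * S.inn x a / S.inn a a) • a := rfl

lemma refl_self {a : Module.Dual ℝ A} (ha : a ≠ 0) : S.toRootWeightData.refl a a = -a := by
  have := (S.inn_pos a ha).ne'
  rw [refl_apply, mul_div_assoc, div_self this, mul_one, two_smul]
  abel

lemma refl_refl {a : Module.Dual ℝ A} (ha : a ≠ 0) (x : Module.Dual ℝ A) :
    S.toRootWeightData.refl a (S.toRootWeightData.refl a x) = x := by
  have h := refl_self S ha
  have e : S.reflL a (S.reflL a x) = x := by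
    have h1 : S.reflL a x = x - (2 * S.inn x a / S.inn a a) • a := rfl
    have h2 : S.reflL a a = -a := h
    rw [h1, map_sub, map_smul, h1, h2]
    simp
  exact e

lemma refl_mem_weyl {a : Module.Dual ℝ A} (ha : a ∈ S.Φ) :
    S.toRootWeightData.refl a ∈ S.toRootWeightData.weyl :=
  Submonoid.subset_closure ⟨a, ha, rfl⟩

lemma inn_refl {a : Module.Dual ℝ A} (ha : a ∈ S.Φ) (x y : Module.Dual ℝ A) :
    S.inn (S.toRootWeightData.refl a x) y = S.inn x (S.toRootWeightData.refl a y) := by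
  have h := S.inn_weyl_invariant _ (S.refl_mem_weyl ha) x (S.toRootWeightData.refl a y)
  rwa [S.refl_refl (S.root_ne_zero a ha)] at h

variable {S}

lemma dominant {Δ : Finset (Module.Dual ℝ A)} (hB : S.toRootWeightData.IsBase Δ)
    {a : Module.Dual ℝ A} (ha : a ∈ Δ) : 0 ≤ S.inn (S.lam0 Δ) a := by
  have haΦ : a ∈ S.Φ := hB.1 ha
  obtain ⟨n, hn, e⟩ := S.lam0_dominates Δ hB _
    (S.weight_weyl_invariant _ (S.refl_mem_weyl haΦ) _ (S.lam0_mem Δ hB))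
  rw [refl_apply, sub_sub_cancel] at e
  have e' : ∑ b ∈ Δ, (fun b => if b = a then 2 * S.inn (S.lam0 Δ) a / S.inn a a else 0) b • b
      = ∑ b ∈ Δ, n b • b := by
    rw [← e]; simp [ha]
  have h := li hB e' a ha
  simp only [if_true] at h
  have hp := S.inn_pos a (S.root_ne_zero a haΦ)
  have h2 := hn a ha
  rw [← h] at h2
  by_contra hlt
  push Not at hlt
  have : 2 * S.inn (S.lam0 Δ) a / S.inn a a < 0 := div_neg_of_neg_of_pos (by linarith) hp
  linarith

lemma refl_pos {Δ : Finset (Module.Dual ℝ A)} (hB : S.toRootWeightData.IsBase Δ)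
    {a b : Module.Dual ℝ A} (hb : b ∈ Δ) (ha : a ∈ S.Φ) (hc : InCone Δ a)
    (hne : ∀ t : ℝ, 0 ≤ t → a ≠ t • b) : InCone Δ (S.toRootWeightData.refl b a) := by
  rcases hB.2.2 _ (S.refl_mem b (hB.1 hb) a ha) with h | ⟨m, hm, em⟩
  · exact h
  · exfalso
    obtain ⟨n, hn, en⟩ := hc
    rw [refl_apply] at em
    set k := 2 * S.inn a b / S.inn b b
    have e : ∑ c ∈ Δ, (n c + m c) • c = ∑ c ∈ Δ, (fun c => if c = b then k else 0) c • c := by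
      simp only [add_smul, Finset.sum_add_distrib, ← en]
      have : ∑ c ∈ Δ, m c • c = k • b - a := by rw [← neg_sub, em, neg_neg]
      rw [this]; simp [hb]
    have h := li hB e
    refine hne (n b) (hn b hb) ?_
    rw [en]
    refine Finset.sum_eq_single_of_mem b hb fun c hc hcb => ?_
    have h1 := h c hc
    simp only [hcb, if_false] at h1
    have h2 := hn c hc
    have h3 := hm c hc
    rw [show n c = 0 by linarith, zero_smul]

lemma inn_nonneg_of_cone {Δ : Finset (Module.Dual ℝ A)} {l v : Module.Dual ℝ A}
    (h : ∀ a ∈ Δ, 0 ≤ S.inn l a) (hv : InCone Δ v) : 0 ≤ S.inn l v := by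
  obtain ⟨n, hn, rfl⟩ := hv
  rw [S.inn_symm]
  change 0 ≤ S.innL l _
  rw [map_sum]
  refine Finset.sum_nonneg fun b hb => ?_
  rw [map_smul]
  refine mul_nonneg (hn b hb) ?_
  change 0 ≤ S.inn b l
  rw [S.inn_symm]
  exact h b hb

/-- If cones are included then the highest weights agree. -/
lemma lam0_eq_of_cone {Δ Δ' : Finset (Module.Dual ℝ A)} (hB : S.toRootWeightData.IsBase Δ)
    (hB' : S.toRootWeightData.IsBase Δ') (h : ∀ b ∈ Δ, InCone Δ' b) :
    S.lam0 Δ = S.lam0 Δ' := by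
  have h1 : InCone Δ (S.lam0 Δ - S.lam0 Δ') := S.lam0_dominates Δ hB _ (S.lam0_mem Δ' hB')
  have h2 : InCone Δ' (S.lam0 Δ' - S.lam0 Δ) := S.lam0_dominates Δ' hB' _ (S.lam0_mem Δ hB)
  have h3 : InCone Δ' (S.lam0 Δ - S.lam0 Δ') := InCone.map LinearMap.id h h1
  rw [← neg_sub] at h2
  exact sub_eq_zero.1 (cone_antisymm hB' h3 h2)

lemma isBase_congr {T : RootWeightSystem A} (hΦ : S.Φ = T.Φ) {Δ : Finset (Module.Dual ℝ A)}
    (h : S.toRootWeightData.IsBase Δ) : T.toRootWeightData.IsBase Δ := by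
  unfold RootWeightData.IsBase at h ⊢
  rwa [← hΦ]

lemma refl_congr {T : RootWeightSystem A} (hinn : S.inn = T.inn) (a : Module.Dual ℝ A) :
    S.toRootWeightData.refl a = T.toRootWeightData.refl a := by
  unfold RootWeightData.refl
  rw [hinn]

/-- The two highest weights for `Δ` lie in the same face. -/
def SameSign (S T : RootWeightSystem A) (Δ : Finset (Module.Dual ℝ A)) : Prop :=
  ∀ a ∈ S.Φ, (0 < S.inn (S.lam0 Δ) a ↔ 0 < S.inn (T.lam0 Δ) a) ∧
      (S.inn (S.lam0 Δ) a = 0 ↔ S.inn (T.lam0 Δ) a = 0)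

lemma SameSign.symm {T : RootWeightSystem A} (hΦ : S.Φ = T.Φ) (hinn : S.inn = T.inn)
    {Δ : Finset (Module.Dual ℝ A)} (h : SameSign S T Δ) : SameSign T S Δ := by
  intro a ha
  rw [← hinn]
  rw [← hΦ] at ha
  exact ⟨(h a ha).1.symm, (h a ha).2.symm⟩

lemma SameSign.nonneg {T : RootWeightSystem A} {Δ : Finset (Module.Dual ℝ A)}
    (h : SameSign S T Δ) {a : Module.Dual ℝ A} (ha : a ∈ S.Φ) :
    0 ≤ S.inn (S.lam0 Δ) a ↔ 0 ≤ S.inn (T.lam0 Δ) a := by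
  rw [le_iff_lt_or_eq, le_iff_lt_or_eq, (h a ha).1, eq_comm, (h a ha).2, eq_comm]

lemma sameSign_all {T : RootWeightSystem A} (hΦ : S.Φ = T.Φ) (hinn : S.inn = T.inn)
    {Δref : Finset (Module.Dual ℝ A)} (href : S.toRootWeightData.IsBase Δref)
    (hs : SameSign S T Δref) (N : ℕ) : ∀ Δ : Finset (Module.Dual ℝ A),
    S.toRootWeightData.IsBase Δ →
    (S.Φ.filter fun a => InCone Δref a ∧ ¬ InCone Δ a).card ≤ N → SameSign S T Δ := by
  induction N with
  | zero =>
    intro Δ hB hN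
    have hsub : ∀ b ∈ Δref, InCone Δ b := by
      intro b hb
      by_contra hc
      have : b ∈ S.Φ.filter fun a => InCone Δref a ∧ ¬ InCone Δ a :=
        Finset.mem_filter.2 ⟨href.1 hb, InCone.of_mem hb, hc⟩
      rw [Finset.card_eq_zero.1 (Nat.le_zero.1 hN)] at this
      simp at this
    have e1 := lam0_eq_of_cone href hB hsub
    have e2 := lam0_eq_of_cone (isBase_congr hΦ href) (isBase_congr hΦ hB) hsub
    unfold SameSign at hs ⊢
    rwa [← e1, ← e2]
  | succ N ih =>
    intro Δ hB hN
    by_cases hsub : ∀ b ∈ Δref, InCone Δ b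
    · have e1 := lam0_eq_of_cone href hB hsub
      have e2 := lam0_eq_of_cone (isBase_congr hΦ href) (isBase_congr hΦ hB) hsub
      unfold SameSign at hs ⊢
      rwa [← e1, ← e2]
    push Not at hsub
    obtain ⟨b, hb, hbn⟩ := hsub
    have hbΦ : b ∈ S.Φ := href.1 hb
    have hb0 := S.root_ne_zero b hbΦ
    have hnegb : InCone Δ (-b) := by
      rcases hB.2.2 b hbΦ with h | ⟨m, hm, em⟩
      · exact absurd h hbn
      · exact ⟨m, hm, by rw [em, neg_neg]⟩
    have hw := S.refl_mem_weyl hbΦ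
    have hB' := S.base_weyl _ hw Δ hB
    have hcard := ih _ hB' (by
      refine Nat.le_of_lt_succ (lt_of_lt_of_le ?_ hN)
      have hbm : b ∈ S.Φ.filter fun a => InCone Δref a ∧ ¬ InCone Δ a :=
        Finset.mem_filter.2 ⟨hbΦ, InCone.of_mem hb, hbn⟩
      refine lt_of_le_of_lt ?_ (Finset.card_erase_lt_of_mem hbm)
      refine Finset.card_le_card_of_injOn (S.toRootWeightData.refl b) ?_ ?_
      · intro a ha
        obtain ⟨haΦ, hac, han⟩ := Finset.mem_filter.1 ha
        have hsn : ¬ InCone Δ (S.toRootWeightData.refl b a) := by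
          intro hc
          apply han
          have := InCone.map (S.reflL b)
            (Δ' := Δ.image (S.toRootWeightData.refl b : Module.Dual ℝ A → Module.Dual ℝ A))
            (fun c hc => InCone.of_mem (Finset.mem_image_of_mem _ hc)) hc
          change InCone _ (S.toRootWeightData.refl b (S.toRootWeightData.refl b a)) at this
          rwa [S.refl_refl hb0] at this
        have hne : ∀ t : ℝ, 0 ≤ t → a ≠ t • b := by
          rintro t ht rfl
          apply hsn
          have : S.toRootWeightData.refl b (t • b) = t • (-b) := by
            rw [← S.refl_self hb0]
            exact (S.reflL b).map_smul t b
          rw [this]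
          exact hnegb.smul ht
        refine Finset.mem_coe.2 (Finset.mem_erase.2 ⟨?_, Finset.mem_filter.2
          ⟨S.refl_mem b hbΦ a haΦ, refl_pos href hb haΦ hac hne, hsn⟩⟩)
        intro h
        have h2 : a = -b := by
          rw [← S.refl_refl hb0 a, h, S.refl_self hb0]
        rw [h2] at hac
        exact hb0 (cone_antisymm href (InCone.of_mem hb) hac)
      · intro a _ a' _ h
        have := congrArg (S.toRootWeightData.refl b) h
        rwa [S.refl_refl hb0, S.refl_refl hb0] at this)
    intro a ha
    have h := hcard _ (S.refl_mem b hbΦ a ha)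
    have eS := S.lam0_equivariant _ hw Δ hB
    have eT := T.lam0_equivariant _ (T.refl_mem_weyl (hΦ ▸ hbΦ)) Δ (isBase_congr hΦ hB)
    rw [← refl_congr hinn] at eT
    rw [eS, eT] at h
    rw [← S.inn_refl hbΦ, ← S.inn_refl hbΦ, S.refl_refl hb0, S.refl_refl hb0] at h
    exact h

lemma le_norm {Δ Δ' : Finset (Module.Dual ℝ A)} (hB : S.toRootWeightData.IsBase Δ)
    (hB' : S.toRootWeightData.IsBase Δ') (hd : ∀ a ∈ Δ', 0 ≤ S.inn (S.lam0 Δ) a) :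
    S.inn (S.lam0 Δ) (S.lam0 Δ) + S.inn (S.lam0 Δ' - S.lam0 Δ) (S.lam0 Δ' - S.lam0 Δ)
      ≤ S.inn (S.lam0 Δ') (S.lam0 Δ') := by
  have hv : InCone Δ' (S.lam0 Δ' - S.lam0 Δ) := S.lam0_dominates Δ' hB' _ (S.lam0_mem Δ hB)
  have h := inn_nonneg_of_cone hd hv
  set v := S.lam0 Δ' - S.lam0 Δ with hvd
  have e : S.lam0 Δ' = S.lam0 Δ + v := by rw [hvd]; abel
  rw [e, S.inn_add_left, S.inn_add_right, S.inn_add_right, S.inn_symm v (S.lam0 Δ)]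
  linarith

lemma inn_self_nonneg (x : Module.Dual ℝ A) : 0 ≤ S.inn x x := by
  by_cases h : x = 0
  · rw [h]
    exact ((S.innL 0).map_zero).ge
  · exact (S.inn_pos x h).le

lemma lam0_eq_of_dominant {Δ Δ' : Finset (Module.Dual ℝ A)} (hB : S.toRootWeightData.IsBase Δ)
    (hB' : S.toRootWeightData.IsBase Δ') (hd : ∀ a ∈ Δ', 0 ≤ S.inn (S.lam0 Δ) a)
    (hd' : ∀ a ∈ Δ, 0 ≤ S.inn (S.lam0 Δ') a) : S.lam0 Δ' = S.lam0 Δ := by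
  have h1 := le_norm hB hB' hd
  have h2 := le_norm hB' hB hd'
  have h3 := inn_self_nonneg (S := S) (S.lam0 Δ - S.lam0 Δ')
  by_contra hne
  have := S.inn_pos _ (sub_ne_zero.2 hne)
  linarith

lemma lam0_transfer {T : RootWeightSystem A} (hΦ : S.Φ = T.Φ) (hinn : S.inn = T.inn)
    {Δ Δ' : Finset (Module.Dual ℝ A)} (hB : S.toRootWeightData.IsBase Δ)
    (hB' : S.toRootWeightData.IsBase Δ') (hs : SameSign S T Δ) (hs' : SameSign S T Δ')
    (e : S.lam0 Δ' = S.lam0 Δ) : T.lam0 Δ' = T.lam0 Δ := by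
  refine lam0_eq_of_dominant (isBase_congr hΦ hB) (isBase_congr hΦ hB') ?_ ?_
  · intro a ha
    rw [← hinn, ← hs.nonneg (hB'.1 ha), ← e]
    exact dominant hB' ha
  · intro a ha
    rw [← hinn, ← hs'.nonneg (hB.1 ha), e]
    exact dominant hB ha

lemma graphConnected_transfer {Y : Finset (Module.Dual ℝ A)}
    {l m : Module.Dual ℝ A} (h : ∀ a ∈ Y, S.inn l a ≠ 0 ↔ S.inn m a ≠ 0)
    (h0 : ∀ a ∈ Y, a ≠ 0)
    (hc : GraphConnected S.inn ((↑Y : Set (Module.Dual ℝ A)) ∪ {l})) :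
    GraphConnected S.inn ((↑Y : Set (Module.Dual ℝ A)) ∪ {m}) := by
  set R' : Module.Dual ℝ A → Module.Dual ℝ A → Prop := fun x y =>
    x ∈ (↑Y : Set (Module.Dual ℝ A)) ∪ {m} ∧ y ∈ (↑Y : Set (Module.Dual ℝ A)) ∪ {m} ∧
      S.inn x y ≠ 0 with hR'
  let φ : Module.Dual ℝ A → Module.Dual ℝ A := fun x => if x ∈ Y then x else m
  have hmm : m ∈ (↑Y : Set (Module.Dual ℝ A)) ∪ {m} := Or.inr rfl
  have key : ∀ x ∈ (↑Y : Set (Module.Dual ℝ A)) ∪ {l},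
      ∀ y ∈ (↑Y : Set (Module.Dual ℝ A)) ∪ {l}, Relation.ReflTransGen R' (φ x) (φ y) := by
    intro x hx y hy
    refine Relation.ReflTransGen.lift' φ ?_ _ _ (hc x hx y hy)
    rintro u v ⟨hu, hv, huv⟩
    change Relation.ReflTransGen R' (φ u) (φ v)
    by_cases hu' : u ∈ Y <;> by_cases hv' : v ∈ Y
    · simp only [φ, hu', hv', if_true]
      exact .single ⟨Or.inl hu', Or.inl hv', huv⟩
    · have : v = l := hv.resolve_left hv'
      subst this
      simp only [φ, hu', hv', if_true, if_false]
      refine .single ⟨Or.inl hu', hmm, ?_⟩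
      rw [S.inn_symm] at huv ⊢
      exact (h u hu').1 huv
    · have : u = l := hu.resolve_left hu'
      subst this
      simp only [φ, hu', hv', if_true, if_false]
      exact .single ⟨hmm, Or.inl hv', (h v hv').1 huv⟩
    · simp only [φ, hu', hv', if_false]
      exact .refl
  have key2 : ∀ x ∈ (↑Y : Set (Module.Dual ℝ A)) ∪ {m},
      Relation.ReflTransGen R' x (φ l) ∧ Relation.ReflTransGen R' (φ l) x := by
    have hY : ∀ x ∈ Y, Relation.ReflTransGen R' x (φ l) ∧ Relation.ReflTransGen R' (φ l) x := by
      intro x hx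
      have e : φ x = x := by simp [φ, hx]
      have h1 := key x (Or.inl hx) l (Or.inr rfl)
      have h2 := key l (Or.inr rfl) x (Or.inl hx)
      rw [e] at h1 h2
      exact ⟨h1, h2⟩
    rintro x (hx | hx)
    · exact hY x hx
    · have hx : x = m := hx
      subst hx
      by_cases hl : l ∈ Y
      · have hne : S.inn x l ≠ 0 := (h l hl).1 (S.inn_pos l (h0 l hl)).ne'
        have hne' : S.inn l x ≠ 0 := by rwa [S.inn_symm]
        have := hY l hl
        exact ⟨.head ⟨hmm, Or.inl hl, hne⟩ this.1, .tail this.2 ⟨Or.inl hl, hmm, hne'⟩⟩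
      · have e : φ l = x := by simp [φ, hl]
        rw [e]
        exact ⟨.refl, .refl⟩
  intro x hx y hy
  exact (key2 x hx).1.trans (key2 y hy).2

lemma admissible_transfer {T : RootWeightSystem A} (hinn : S.inn = T.inn)
    {Δ : Finset (Module.Dual ℝ A)} (hB : S.toRootWeightData.IsBase Δ) (hs : SameSign S T Δ)
    {Y : Finset (Module.Dual ℝ A)} (h : S.toRootWeightData.Admissible Δ Y) :
    T.toRootWeightData.Admissible Δ Y := by
  refine ⟨h.1, ?_⟩
  rw [← hinn]
  refine graphConnected_transfer (fun a ha => ?_) (fun a ha => ?_) h.2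
  · exact not_congr (hs a (hB.1 (h.1 ha))).2
  · exact S.root_ne_zero a (hB.1 (h.1 ha))

/-- Roots of an admissible set which vanish at `x` lie in the span of the weight differences
vanishing at `x`. -/
lemma admissible_span {Δ Z : Finset (Module.Dual ℝ A)} (hB : S.toRootWeightData.IsBase Δ)
    (hZ : S.toRootWeightData.Admissible Δ Z) {x : A} (hx : ∀ z ∈ Z, z x = 0)
    (U : Submodule ℝ (Module.Dual ℝ A))
    (hU : ∀ l ∈ S.Λ, (S.lam0 Δ - l) x = 0 → S.lam0 Δ - l ∈ U) : ∀ z ∈ Z, z ∈ U := by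
  have hrefl : ∀ l ∈ S.Λ, (S.lam0 Δ - l) x = 0 → ∀ z ∈ Z,
      S.toRootWeightData.refl z l ∈ S.Λ ∧ (S.lam0 Δ - S.toRootWeightData.refl z l) x = 0 := by
    intro l hl h z hz
    refine ⟨S.weight_weyl_invariant _ (S.refl_mem_weyl (hB.1 (hZ.1 hz))) l hl, ?_⟩
    rw [refl_apply]
    simp only [LinearMap.sub_apply, LinearMap.smul_apply, hx z hz, smul_zero, sub_zero] at h ⊢
    exact h
  have hpos : ∀ z ∈ Z, 0 < S.inn z z := fun z hz =>
    S.inn_pos z (S.root_ne_zero z (hB.1 (hZ.1 hz)))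
  have h0 : (S.lam0 Δ - S.lam0 Δ) x = 0 := by simp
  have hQ : ∀ z, Relation.ReflTransGen (fun u v =>
      u ∈ (↑Z : Set (Module.Dual ℝ A)) ∪ {S.lam0 Δ} ∧
      v ∈ (↑Z : Set (Module.Dual ℝ A)) ∪ {S.lam0 Δ} ∧ S.inn u v ≠ 0) (S.lam0 Δ) z →
      z = S.lam0 Δ ∨ (z ∈ Z ∧ ∃ l ∈ S.Λ, (S.lam0 Δ - l) x = 0 ∧ S.inn l z ≠ 0) := by
    intro z hz
    induction hz with
    | refl => exact Or.inl rfl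
    | @tail u v _ huv ih =>
      obtain ⟨-, hv, huv⟩ := huv
      rcases hv with hv | hv
      swap
      · exact Or.inl hv
      refine Or.inr ⟨hv, ?_⟩
      rcases ih with rfl | ⟨hu, l, hl, hlx, hlu⟩
      · exact ⟨S.lam0 Δ, S.lam0_mem Δ hB, h0, huv⟩
      · by_cases hlv : S.inn l v = 0
        · obtain ⟨h1, h2⟩ := hrefl l hl hlx u hu
          refine ⟨_, h1, h2, ?_⟩
          rw [refl_apply, S.inn_sub_left, S.inn_smul_left, hlv, zero_sub, neg_ne_zero]
          exact mul_ne_zero (div_ne_zero (mul_ne_zero two_ne_zero hlu) (hpos u hu).ne') huv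
        · exact ⟨l, hl, hlx, hlv⟩
  intro z hz
  have : ∃ l ∈ S.Λ, (S.lam0 Δ - l) x = 0 ∧ S.inn l z ≠ 0 := by
    rcases hQ z (hZ.2 _ (Or.inr rfl) z (Or.inl hz)) with h | h
    · refine ⟨S.lam0 Δ, S.lam0_mem Δ hB, h0, ?_⟩
      rw [← h]
      exact (hpos z hz).ne'
    · exact h.2
  obtain ⟨l, hl, hlx, hlz⟩ := this
  obtain ⟨h1, h2⟩ := hrefl l hl hlx z hz
  have h3 := U.sub_mem (hU _ h1 h2) (hU l hl hlx)
  rw [refl_apply, sub_sub_sub_cancel_left, sub_sub_cancel] at h3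
  exact (U.smul_mem_iff
    (div_ne_zero (mul_ne_zero two_ne_zero hlz) (hpos z hz).ne')).1 h3

lemma face_subset {T : RootWeightSystem A} (hΦ : S.Φ = T.Φ) (hinn : S.inn = T.inn)
    (hs : ∀ Δ, S.toRootWeightData.IsBase Δ → SameSign S T Δ)
    {Δ : Finset (Module.Dual ℝ A)} (hB : S.toRootWeightData.IsBase Δ)
    {Y : Finset (Module.Dual ℝ A)} (hY : Y ⊆ Δ) : S.Face Δ Y ⊆ T.Face Δ Y := by
  rintro x ⟨hx0, hx⟩
  obtain ⟨y, hy⟩ := exists_pos hB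
  obtain ⟨ε, hε, hεp⟩ := exists_eps (S.Φ ∪ S.Λ.image (fun l => S.lam0 Δ - l)) x y
  obtain ⟨Δ', hB', hd⟩ := S.base_cover (x + ε • y)
  have hdx : ∀ a ∈ Δ', 0 ≤ a x := by
    intro a ha
    by_contra hlt
    push Not at hlt
    have := hεp (-a) (Finset.mem_union_left _ (S.neg_mem a (hB'.1 ha))) (by simpa using hlt)
    have h2 := hd a ha
    rw [LinearMap.neg_apply] at this
    linarith
  have hconex : ∀ (z : A) (μ : Module.Dual ℝ A), (∀ a ∈ Δ', 0 ≤ a z) → InCone Δ' μ →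
      0 ≤ μ z := by
    rintro z μ hz ⟨n, hn, rfl⟩
    simp only [LinearMap.sum_apply, LinearMap.smul_apply, smul_eq_mul]
    exact Finset.sum_nonneg fun b hb => mul_nonneg (hn b hb) (hz b hb)
  -- vanishing at `x`
  have hvan : ∀ l ∈ S.Λ, (S.lam0 Δ - l) x = 0 → supp Δ (S.lam0 Δ - l) ⊆ Y := by
    intro l hl h
    by_contra hc
    exact (hx l hl hc).ne' h
  have eS : S.lam0 Δ' = S.lam0 Δ := by
    have h1 : 0 ≤ (S.lam0 Δ' - S.lam0 Δ) (x + ε • y) :=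
      hconex _ _ hd (S.lam0_dominates Δ' hB' _ (S.lam0_mem Δ hB))
    have hm := S.lam0_mem Δ' hB'
    have hcone : InCone Δ (S.lam0 Δ - S.lam0 Δ') := S.lam0_dominates Δ hB _ hm
    rw [← neg_sub, LinearMap.neg_apply] at h1
    obtain ⟨hc1, hc2⟩ := eq_sum_coeffs hB hcone
    by_cases hsY : supp Δ (S.lam0 Δ - S.lam0 Δ') ⊆ Y
    · have hxz : (S.lam0 Δ - S.lam0 Δ') x = 0 := by
        rw [hc2]
        simp only [LinearMap.sum_apply, LinearMap.smul_apply, smul_eq_mul]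
        exact Finset.sum_eq_zero fun b hb => by rw [hx0 b (hsY hb), mul_zero]
      rw [map_add, hxz, map_smul, zero_add, smul_eq_mul] at h1
      have hyle : (S.lam0 Δ - S.lam0 Δ') y ≤ 0 := by
        by_contra hlt
        push Not at hlt
        have := mul_pos hε hlt
        linarith
      have hsy : (S.lam0 Δ - S.lam0 Δ') y
          = ∑ b ∈ supp Δ (S.lam0 Δ - S.lam0 Δ'), coeffs Δ (S.lam0 Δ - S.lam0 Δ') b := by
        conv_lhs => rw [hc2]
        simp only [LinearMap.sum_apply, LinearMap.smul_apply, smul_eq_mul]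
        exact Finset.sum_congr rfl fun b hb => by
          rw [hy b (Finset.mem_filter.1 hb).1, mul_one]
      have hnn : ∀ b ∈ supp Δ (S.lam0 Δ - S.lam0 Δ'), 0 ≤ coeffs Δ (S.lam0 Δ - S.lam0 Δ') b :=
        fun b hb => hc1 b (Finset.mem_filter.1 hb).1
      have hz := (Finset.sum_eq_zero_iff_of_nonneg hnn).1
        (le_antisymm (hsy ▸ hyle) (Finset.sum_nonneg hnn))
      have : S.lam0 Δ - S.lam0 Δ' = 0 := by
        rw [hc2]
        exact Finset.sum_eq_zero fun b hb => by rw [hz b hb, zero_smul]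
      exact (sub_eq_zero.1 this).symm
    · have := hεp _ (Finset.mem_union_right _ (Finset.mem_image_of_mem _ hm)) (hx _ hm hsY)
      linarith
  have eT : T.lam0 Δ' = T.lam0 Δ := lam0_transfer hΦ hinn hB hB' (hs Δ hB) (hs Δ' hB') eS
  have hTB := isBase_congr hΦ hB
  have hTB' := isBase_congr hΦ hB'
  refine ⟨hx0, fun l hl hls => ?_⟩
  have hcone : InCone Δ' (T.lam0 Δ - l) := eT ▸ T.lam0_dominates Δ' hTB' l hl
  have hge := hconex x _ hdx hcone
  refine lt_of_le_of_ne hge fun heq => hls ?_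
  obtain ⟨hc1, hc2⟩ := eq_sum_coeffs hB' hcone
  set Z := supp Δ' (T.lam0 Δ - l) with hZ
  have hZΔ : Z ⊆ Δ' := Finset.filter_subset _ _
  have hZT : T.toRootWeightData.Admissible Δ' Z :=
    (T.admissible_iff_support Δ' hTB' Z hZΔ).2 ⟨l, hl, by rw [eT]⟩
  have hZS : S.toRootWeightData.Admissible Δ' Z :=
    admissible_transfer hinn.symm hTB' ((hs Δ' hB').symm hΦ hinn) hZT
  have hZx : ∀ z ∈ Z, z x = 0 := by
    have hsum : ∑ b ∈ Z, coeffs Δ' (T.lam0 Δ - l) b * b x = 0 := by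
      rw [heq]
      conv_rhs => rw [hc2]
      simp only [LinearMap.sum_apply, LinearMap.smul_apply, smul_eq_mul]
    intro z hz
    have := (Finset.sum_eq_zero_iff_of_nonneg fun b hb =>
      mul_nonneg (hc1 b (hZΔ hb)) (hdx b (hZΔ hb))).1 hsum z hz
    exact (mul_eq_zero.1 this).resolve_left (Finset.mem_filter.1 hz).2
  have hZU := admissible_span hB' hZS hZx (Submodule.span ℝ (Y : Set (Module.Dual ℝ A))) (by
    intro k hk hkx
    rw [eS] at hkx ⊢
    have hsub := hvan k hk hkx
    rw [(eq_sum_coeffs hB (S.lam0_dominates Δ hB k hk)).2]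
    exact Submodule.sum_mem _ fun b hb =>
      Submodule.smul_mem _ _ (Submodule.subset_span (hsub hb)))
  refine supp_subset_of_mem_span hTB hY ?_
  rw [hc2]
  exact Submodule.sum_mem _ fun b hb => Submodule.smul_mem _ _ (hZU b hb)

end RootWeightSystem

end Helpers

/-- Suppose the highest weights of `ρ` and `σ` lie in the same
face of the hyperplane arrangement `{H_a}_{a ∈ Φ}` of `A*`.  Then for every basis
`Δ`, a subset `Y ⊆ Δ` is admissible for `ρ` iff it is admissible for `σ`, and for
such `Y` the faces agree: `F_Y^Δ(ρ) = F_Y^Δ(σ)`; in particular `ρ` and `σ` induce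
the same decomposition of `A` into faces. -/
theorem same_faces_of_same_face (S T : RootWeightSystem A)
    (hΦ : S.Φ = T.Φ) (hinn : S.inn = T.inn)
    (Δref : Finset (Module.Dual ℝ A)) (hΔref : S.toRootWeightData.IsBase Δref)
    (hsame : ∀ a ∈ S.Φ, (0 < S.inn (S.lam0 Δref) a ↔ 0 < S.inn (T.lam0 Δref) a) ∧
      (S.inn (S.lam0 Δref) a = 0 ↔ S.inn (T.lam0 Δref) a = 0))
 :
    ∀ Δ : Finset (Module.Dual ℝ A), S.toRootWeightData.IsBase Δ →
      ∀ Y ⊆ Δ,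
        (S.toRootWeightData.Admissible Δ Y ↔ T.toRootWeightData.Admissible Δ Y) ∧
        (S.toRootWeightData.Admissible Δ Y → S.Face Δ Y = T.Face Δ Y) := by
  have hall : ∀ Δ, S.toRootWeightData.IsBase Δ → RootWeightSystem.SameSign S T Δ :=
    fun Δ hB => RootWeightSystem.sameSign_all hΦ hinn hΔref hsame _ Δ hB le_rfl
  have hall' : ∀ Δ, T.toRootWeightData.IsBase Δ → RootWeightSystem.SameSign T S Δ :=
    fun Δ hB => (hall Δ (RootWeightSystem.isBase_congr hΦ.symm hB)).symm hΦ hinn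
  intro Δ hB Y hY
  have hTB := RootWeightSystem.isBase_congr hΦ hB
  refine ⟨⟨RootWeightSystem.admissible_transfer hinn hB (hall Δ hB),
    RootWeightSystem.admissible_transfer hinn.symm hTB (hall' Δ hTB)⟩, fun _ => ?_⟩
  exact Set.Subset.antisymm (RootWeightSystem.face_subset hΦ hinn hall hB hY)
    (RootWeightSystem.face_subset hΦ.symm hinn.symm hall' hTB hY)
end
end
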